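/- Fix 1 < p < 2 and let E*(p) = inf{∑_{x∼y}|φ_x − φ_y|^p : φ : ℤ² → ℝ finitely supported, φ_0 = 1}. There exists β₀ = β₀(p) such that for every β ≥ β₀ and every ε > 0 there exists h₀ such that for every integer h ≥ h₀ there exists L₀ = L₀(β,h) with: for all integers L ≥ L₀, exp(−β(E*(p)+ε)h^p) ≤ π^{(p)}_{B_L}(η_0 = h) ≤ exp(−β(E*(p)−ε)h^p). -/

import Mathlib

open Filter Topology Classical

noncomputable section

abbrev Site : Type := ℤ × ℤ

/-- Nearest-neighbor adjacency in `ℤ²`. -/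
def adjP (x y : Site) : Prop := |x.1 - y.1| + |x.2 - y.2| = 1

/-- The `p`-SOS Hamiltonian `∑_{x∼y} |η_x − η_y|^p` (each ordered pair counted once,
whence the factor 1/2). -/
def pH (p : ℝ) (η : Site → ℤ) : ℝ :=
  (1 / 2) * ∑' pr : Site × Site,
    if adjP pr.1 pr.2 then ((|η pr.1 - η pr.2| : ℤ) : ℝ) ^ p else 0

/-- Unnormalized weight of the event `A` for the `p`-SOS model on `Λ` with zero
boundary conditions. -/
def pW (p β : ℝ) (Λ : Finset Site) (A : (Site → ℤ) → Prop) : ℝ :=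
  ∑' η : Site → ℤ, if (∀ x ∉ Λ, η x = 0) ∧ A η then Real.exp (-β * pH p η) else 0

/-- `π^{(p)}_Λ(A)`: probability of the event `A` under the `p`-SOS measure on `Λ`. -/
def pProb (p β : ℝ) (Λ : Finset Site) (A : (Site → ℤ) → Prop) : ℝ :=
  pW p β Λ A / pW p β Λ (fun _ => True)

/-- The lattice ball `B_r = {x ∈ ℤ² : |x| ≤ r}`. -/
def ball (r : ℝ) : Finset Site :=
  ((Finset.Icc (-⌈r⌉) ⌈r⌉) ×ˢ (Finset.Icc (-⌈r⌉) ⌈r⌉)).filter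
    fun x => ((x.1 : ℝ) ^ 2 + (x.2 : ℝ) ^ 2 ≤ r ^ 2)

/-- The `p`-Dirichlet energy of a real-valued configuration. -/
def pDir (p : ℝ) (φ : Site → ℝ) : ℝ :=
  (1 / 2) * ∑' pr : Site × Site, if adjP pr.1 pr.2 then |φ pr.1 - φ pr.2| ^ p else 0

/-- `E*(p)`: the infimum of the `p`-Dirichlet energy over finitely supported real-valued
`φ` with `φ_0 = 1`. -/
def Estar (p : ℝ) : ℝ :=
  sInf {E | ∃ φ : Site → ℝ, (Function.support φ).Finite ∧ φ (0, 0) = 1 ∧ E = pDir p φ}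

abbrev Edge : Type := Site × Bool

def tgt (e : Edge) : Site := if e.2 then (e.1.1, e.1.2 + 1) else (e.1.1 + 1, e.1.2)

def dd {R : Type} [Sub R] (f : Site → R) (e : Edge) : R := f (tgt e) - f e.1

lemma dd_h {R : Type} [Sub R] (f : Site → R) (x y : ℤ) :
    dd f ((x, y), false) = f (x + 1, y) - f (x, y) := by simp [dd, tgt]

lemma dd_v {R : Type} [Sub R] (f : Site → R) (x y : ℤ) :
    dd f ((x, y), true) = f (x, y + 1) - f (x, y) := by simp [dd, tgt]

lemma dd_sub {R : Type} [AddCommGroup R] (f g : Site → R) (e : Edge) :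
    dd (f - g) e = dd f e - dd g e := by simp only [dd, Pi.sub_apply]; abel

lemma dd_add {R : Type} [AddCommGroup R] (f g : Site → R) (e : Edge) :
    dd (f + g) e = dd f e + dd g e := by simp only [dd, Pi.add_apply]; abel

lemma dd_neg {R : Type} [AddCommGroup R] (f : Site → R) (e : Edge) :
    dd (-f) e = - dd f e := by simp only [dd, Pi.neg_apply]; abel

lemma dd_sum {R ι : Type} [AddCommGroup R] (s : Finset ι) (f : ι → Site → R) (e : Edge) :
    dd (∑ i ∈ s, f i) e = ∑ i ∈ s, dd (f i) e := by
  simp only [dd, Finset.sum_apply, Finset.sum_sub_distrib]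

lemma dd_finite {R : Type} [AddCommGroup R] {f : Site → R} (hf : (Function.support f).Finite) :
    (Function.support (dd f)).Finite := by
  have h1 : ((Function.support f) ×ˢ (Set.univ : Set Bool)).Finite := hf.prod Set.finite_univ
  have h2 := h1.image (fun e : Edge => ((if e.2 then (e.1.1, e.1.2 - 1) else (e.1.1 - 1, e.1.2), e.2) : Edge))
  refine (h1.union h2).subset ?_
  rintro ⟨⟨x, y⟩, b⟩ he
  by_cases h0 : f (x, y) = 0
  · right
    refine ⟨(tgt ((x, y), b), b), ⟨?_, trivial⟩, ?_⟩
    · intro h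
      exact he (by simp [dd, h, h0])
    · cases b <;> simp [tgt]
  · left
    exact ⟨h0, trivial⟩

lemma rp0 {p : ℝ} (hp : 0 < p) : (|(0:ℝ)|) ^ p = 0 := by
  rw [abs_zero, Real.zero_rpow hp.ne']

lemma ddp_finite {p : ℝ} (hp : 0 < p) {f : Site → ℝ} (hf : (Function.support f).Finite) :
    (Function.support (fun e => |dd f e| ^ p)).Finite := by
  refine (dd_finite hf).subset ?_
  intro e he h
  exact he (by simp only [h]; exact rp0 hp)

def jj (e : Bool × Edge) : Site × Site := if e.1 then (tgt e.2, e.2.1) else (e.2.1, tgt e.2)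

lemma jj_inj : Function.Injective jj := by
  rintro ⟨b, ⟨x, y⟩, s⟩ ⟨b', ⟨x', y'⟩, s'⟩ h
  cases b <;> cases b' <;> cases s <;> cases s' <;> simp [jj, tgt] at h ⊢ <;> omega

lemma jj_adj (e : Bool × Edge) : adjP (jj e).1 (jj e).2 := by
  obtain ⟨b, ⟨x, y⟩, s⟩ := e
  cases b <;> cases s <;> simp [jj, tgt, adjP]

lemma jj_surj (a b : Site) (h : adjP a b) : ∃ e, jj e = (a, b) := by
  obtain ⟨x, y⟩ := a
  obtain ⟨x', y'⟩ := b
  simp only [adjP] at h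
  have h4 : (x' = x + 1 ∧ y' = y) ∨ (x' = x ∧ y' = y + 1) ∨ (x' + 1 = x ∧ y' = y) ∨
      (x' = x ∧ y' + 1 = y) := by
    rcases abs_cases (x - x') with h1 | h1 <;> rcases abs_cases (y - y') with h2 | h2 <;> omega
  rcases h4 with ⟨h1, h2⟩ | ⟨h1, h2⟩ | ⟨h1, h2⟩ | ⟨h1, h2⟩
  · exact ⟨(false, (x, y), false), by simp [jj, tgt, h1, h2]⟩
  · exact ⟨(false, (x, y), true), by simp [jj, tgt, h1, h2]⟩
  · exact ⟨(true, (x', y'), false), by simp [jj, tgt, h1, h2]⟩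
  · exact ⟨(true, (x', y'), true), by simp [jj, tgt, h1, h2]⟩

lemma pDir_eq {p : ℝ} (hp : 0 < p) {φ : Site → ℝ} (hf : (Function.support φ).Finite) :
    pDir p φ = ∑' e : Edge, |dd φ e| ^ p := by
  unfold pDir
  set F : Site × Site → ℝ := fun pr => if adjP pr.1 pr.2 then |φ pr.1 - φ pr.2| ^ p else 0 with hF
  have hs : Function.support F ⊆ Set.range jj := by
    rintro ⟨a, b⟩ hab
    by_cases h : adjP a b
    · exact jj_surj a b h
    · exact absurd (by simp [hF, h]) hab
  rw [← jj_inj.tsum_eq hs]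
  have hG : ∀ c : Bool × Edge, F (jj c) = |dd φ c.2| ^ p := by
    rintro ⟨b, e⟩
    have := jj_adj (b, e)
    simp only [hF, this, if_true]
    cases b
    · simp only [jj, dd]; rw [abs_sub_comm]; simp
    · simp [jj, dd]
  simp_rw [hG]
  have hsum : Summable (fun c : Bool × Edge => |dd φ c.2| ^ p) := by
    apply summable_of_hasFiniteSupport
    refine ((Set.finite_univ (α := Bool)).prod (ddp_finite hp hf)).subset ?_
    rintro ⟨b, e⟩ h
    exact ⟨trivial, h⟩
  rw [hsum.tsum_prod]
  simp only [tsum_bool]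
  ring

def HH (p : ℝ) (η : Site → ℤ) : ℝ := ∑' e : Edge, |((dd η e : ℤ) : ℝ)| ^ p

lemma cast_supp {η : Site → ℤ} (h : (Function.support η).Finite) :
    (Function.support (fun x => (η x : ℝ))).Finite := by
  refine h.subset ?_
  intro x hx hx'
  exact hx (by simp [hx'])

lemma cast_dd (η : Site → ℤ) (e : Edge) : dd (fun x => (η x : ℝ)) e = ((dd η e : ℤ) : ℝ) := by
  simp [dd]

lemma pDir_cast {p : ℝ} (hp : 0 < p) {η : Site → ℤ} (h : (Function.support η).Finite) :
    pDir p (fun x => (η x : ℝ)) = HH p η := by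
  rw [pDir_eq hp (cast_supp h)]
  simp only [cast_dd, HH]

lemma pH_eq {p : ℝ} (hp : 0 < p) {η : Site → ℤ} (h : (Function.support η).Finite) :
    pH p η = HH p η := by
  rw [← pDir_cast hp h]
  simp only [pH, pDir, Int.cast_abs, Int.cast_sub]

lemma HH_summable {p : ℝ} (hp : 0 < p) {η : Site → ℤ} (h : (Function.support η).Finite) :
    Summable (fun e : Edge => |((dd η e : ℤ) : ℝ)| ^ p) := by
  apply summable_of_hasFiniteSupport
  have := ddp_finite hp (cast_supp h)
  simp only [cast_dd] at this
  exact this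

lemma HH_nonneg (p : ℝ) (η : Site → ℤ) : 0 ≤ HH p η :=
  tsum_nonneg fun _ => Real.rpow_nonneg (abs_nonneg _) _

section Growth
variable {V : Type} [DecidableEq V]

inductive Grown (nb : V → Finset V) (v0 : V) : Finset V → Prop
  | base : Grown nb v0 {v0}
  | step {T : Finset V} {u v : V} : Grown nb v0 T → u ∈ T → v ∈ nb u → v ∉ T →
      Grown nb v0 (insert v T)

lemma Grown.mem {nb : V → Finset V} {v0 : V} {T : Finset V} (h : Grown nb v0 T) : v0 ∈ T := by
  induction h with
  | base => simp
  | step _ _ _ _ ih => exact Finset.mem_insert_of_mem ih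

def walks (nb : V → Finset V) : ℕ → V → Finset (List V)
  | 0, v => {[v]}
  | m + 1, v => (nb v).biUnion (fun u => (walks nb m u).image (fun l => v :: l))

lemma walks_card (nb : V → Finset V) (D : ℕ) (hD : ∀ v, (nb v).card ≤ D) (m : ℕ) :
    ∀ v, (walks nb m v).card ≤ D ^ m := by
  induction m with
  | zero => intro v; simp [walks]
  | succ m ih =>
    intro v
    simp only [walks]
    refine (Finset.card_biUnion_le_card_mul _ _ (D ^ m) ?_).trans ?_
    · intro u _
      exact Finset.card_image_le.trans (ih u)
    · rw [pow_succ']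
      exact Nat.mul_le_mul_right _ (hD v)

lemma mem_walks (nb : V → Finset V) (t : List V) :
    ∀ v, List.IsChain (fun a b => b ∈ nb a) (v :: t) → (v :: t) ∈ walks nb t.length v := by
  induction t with
  | nil => intro v _; simp [walks]
  | cons u t ih =>
    intro v h
    rw [List.isChain_cons_cons] at h
    simp only [walks, List.length_cons, Finset.mem_biUnion, Finset.mem_image]
    exact ⟨u, h.1, _, ih u h.2, rfl⟩

lemma grown_walk {nb : V → Finset V} (hsym : ∀ u v, v ∈ nb u → u ∈ nb v) {v0 : V} {T : Finset V}
    (h : Grown nb v0 T) : ∃ t : List V, List.IsChain (fun a b => b ∈ nb a) (v0 :: t) ∧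
      t.length + 2 = 2 * T.card ∧ (v0 :: t).toFinset = T := by
  induction h with
  | base => exact ⟨[], by simp⟩
  | @step T u v _ hu hv hvT ih =>
    obtain ⟨t, hc, hl, hT⟩ := ih
    have hu' : u ∈ v0 :: t := by rw [← List.mem_toFinset, hT]; exact hu
    obtain ⟨l1, l2, h12⟩ := List.append_of_mem hu'
    have hlen : l1.length + l2.length = t.length := by
      have := congrArg List.length h12
      simp at this; omega
    have key : List.IsChain (fun a b => b ∈ nb a) (l1 ++ u :: v :: u :: l2) := by
      rw [h12] at hc
      rw [List.isChain_append] at hc ⊢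
      refine ⟨hc.1, ?_, ?_⟩
      · rw [List.isChain_cons_cons, List.isChain_cons_cons]
        exact ⟨hv, hsym _ _ hv, hc.2.1⟩
      · simpa using hc.2.2
    have hset : (l1 ++ u :: v :: u :: l2).toFinset = insert v T := by
      rw [← hT, h12]; ext z; simp
    cases l1 with
    | nil =>
      simp only [List.nil_append, List.cons.injEq] at h12
      obtain ⟨rfl, rfl⟩ := h12
      refine ⟨v :: v0 :: t, key, ?_, hset⟩
      rw [Finset.card_insert_of_notMem hvT]; simp only [List.length_cons]; omega
    | cons a l1 =>
      simp only [List.cons_append, List.cons.injEq] at h12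
      obtain ⟨rfl, h12⟩ := h12
      refine ⟨l1 ++ u :: v :: u :: l2, key, ?_, hset⟩
      rw [Finset.card_insert_of_notMem hvT]; simp at hlen ⊢; omega

lemma grown_count {nb : V → Finset V} (hsym : ∀ u v, v ∈ nb u → u ∈ nb v) (D : ℕ)
    (hD1 : 1 ≤ D) (hD : ∀ v, (nb v).card ≤ D) (v0 : V) (n : ℕ) :
    ∃ S : Finset (Finset V), (∀ T, Grown nb v0 T → T.card = n → T ∈ S) ∧ S.card ≤ D ^ (2 * n) := by
  refine ⟨(walks nb (2 * n - 2) v0).image List.toFinset, ?_, ?_⟩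
  · intro T hT hn
    obtain ⟨t, hc, hl, h⟩ := grown_walk hsym hT
    rw [Finset.mem_image]
    refine ⟨v0 :: t, ?_, h⟩
    have := mem_walks nb t v0 hc
    have h2 : t.length = 2 * n - 2 := by omega
    rwa [h2] at this
  · refine Finset.card_image_le.trans ((walks_card nb D hD _ v0).trans ?_)
    exact Nat.pow_le_pow_right hD1 (by omega)

lemma exists_comp (nb : V → Finset V) (D : Finset V) (v0 : V) (h0 : v0 ∈ D) :
    ∃ C, Grown nb v0 C ∧ C ⊆ D ∧ ∀ u ∈ C, ∀ v ∈ nb u, v ∈ D → v ∈ C := by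
  classical
  let P := D.powerset.filter (fun T => Grown nb v0 T)
  have hP : P.Nonempty := ⟨{v0}, by
    simp only [P, Finset.mem_filter, Finset.mem_powerset, Finset.singleton_subset_iff]
    exact ⟨h0, Grown.base⟩⟩
  obtain ⟨C, hC, hmax⟩ := Finset.exists_max_image P Finset.card hP
  simp only [P, Finset.mem_filter, Finset.mem_powerset] at hC
  refine ⟨C, hC.2, hC.1, ?_⟩
  intro u hu v hv hvD
  by_contra hvC
  have := hmax (insert v C) (by
    simp only [P, Finset.mem_filter, Finset.mem_powerset]
    exact ⟨Finset.insert_subset hvD hC.1, Grown.step hC.2 hu hv hvC⟩)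
  rw [Finset.card_insert_of_notMem hvC] at this
  omega

end Growth

lemma int_bound {f : Edge → ℤ} (hf : (Function.support f).Finite) :
    ∃ N : ℕ, ∀ x y b, f ((x, y), b) ≠ 0 → |x| ≤ N ∧ |y| ≤ N := by
  refine ⟨hf.toFinset.sup (fun e => max e.1.1.natAbs e.1.2.natAbs), ?_⟩
  intro x y b h
  have h1 : ((x, y), b) ∈ hf.toFinset := by simpa using h
  have h2 := Finset.le_sup (f := fun e : Edge => max e.1.1.natAbs e.1.2.natAbs) h1
  simp only at h2
  have h3 := (le_max_left _ _).trans h2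
  have h4 := (le_max_right _ _).trans h2
  constructor
  · rw [Int.abs_eq_natAbs]; exact_mod_cast h3
  · rw [Int.abs_eq_natAbs]; exact_mod_cast h4

lemma site_bound {f : Site → ℤ} (hf : (Function.support f).Finite) :
    ∃ N : ℕ, ∀ x y, f (x, y) ≠ 0 → |x| ≤ N ∧ |y| ≤ N := by
  obtain ⟨N, hN⟩ := int_bound (f := fun e : Edge => f e.1) (by
    refine (hf.prod (Set.finite_univ (α := Bool))).subset ?_
    rintro ⟨a, b⟩ h
    exact ⟨h, trivial⟩)
  exact ⟨N, fun x y h => hN x y true h⟩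

lemma poincare (w : Edge → ℤ) (hw : (Function.support w).Finite)
    (hc : ∀ x y, w ((x, y), false) + w ((x + 1, y), true) = w ((x, y), true) + w ((x, y + 1), false)) :
    ∃ f : Site → ℤ, (Function.support f).Finite ∧ ∀ e, dd f e = w e := by
  obtain ⟨N, hN⟩ := int_bound hw
  have hz : ∀ x y b, ((N : ℤ) < |x| ∨ (N : ℤ) < |y|) → w ((x, y), b) = 0 := by
    intro x y b h
    by_contra h'
    have := hN x y b h'
    omega
  let f : Site → ℤ := fun s => ∑ i ∈ Finset.Ico (-(N : ℤ)) s.1, w ((i, s.2), false)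
  have hf0 : ∀ x y, x ≤ -(N : ℤ) → f (x, y) = 0 := by
    intro x y h
    simp [f, Finset.Ico_eq_empty_of_le h]
  have hh : ∀ x y, f (x + 1, y) - f (x, y) = w ((x, y), false) := by
    intro x y
    by_cases h : -(N : ℤ) ≤ x
    · have : Finset.Ico (-(N : ℤ)) (x + 1) = insert x (Finset.Ico (-(N : ℤ)) x) := by
        ext z; simp; omega
      simp only [f, this]
      rw [Finset.sum_insert (by simp)]
      ring
    · rw [hf0 _ _ (by omega), hf0 _ _ (by omega), hz]
      · simp
      · left; rw [abs_of_neg (by omega)]; omega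
  have hv : ∀ x y, f (x, y + 1) - f (x, y) = w ((x, y), true) := by
    intro x y
    by_cases h : -(N : ℤ) - 1 ≤ x
    · induction x, h using Int.leInduction with
      | base =>
        rw [hf0 _ _ (by omega), hf0 _ _ (by omega), hz]
        · simp
        · left; rw [abs_of_neg (by omega)]; omega
      | succ x hx ih =>
        have h1 := hh x y
        have h2 := hh x (y + 1)
        have h3 := hc x y
        linarith
    · rw [hf0 _ _ (by omega), hf0 _ _ (by omega), hz]
      · simp
      · left; rw [abs_of_neg (by omega)]; omega
  refine ⟨f, ?_, ?_⟩
  · have hy : ∀ x y, (N : ℤ) < |y| → f (x, y) = 0 := by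
      intro x y h
      simp only [f]
      apply Finset.sum_eq_zero
      intro i _
      exact hz _ _ _ (Or.inr h)
    have hx : ∀ x y, (N : ℤ) < x → f (x, y) = 0 := by
      intro x y h
      have hs : ∀ y, f (x, y + 1) = f (x, y) := by
        intro y
        have := hv x y
        rw [hz x y true (Or.inl (by rw [abs_of_pos (by omega)]; exact h))] at this
        linarith
      have hk : ∀ k : ℕ, f (x, y + k) = f (x, y) := by
        intro k
        induction k with
        | zero => simp
        | succ k ih => rw [← ih, ← hs (y + k)]; push_cast; rw [add_assoc]
      have := hk (N + 1 + y.natAbs)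
      rw [← this]
      apply hy
      push_cast
      have := abs_cases y
      have := le_abs_self (y + (N + 1 + |y|))
      omega
    refine ((Finset.Icc (-(N : ℤ)) N) ×ˢ (Finset.Icc (-(N : ℤ)) N)).finite_toSet.subset ?_
    rintro ⟨x, y⟩ h
    simp only [Function.mem_support] at h
    simp only [Finset.coe_product, Set.mem_prod, Finset.coe_Icc, Set.mem_Icc]
    have h1 : ¬ ((N : ℤ) < |y|) := fun h' => h (hy x y h')
    have h2 : ¬ ((N : ℤ) < x) := fun h' => h (hx x y h')
    have h3 : ¬ (x ≤ -(N : ℤ)) := fun h' => h (hf0 x y h')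
    have := abs_cases y
    omega
  · rintro ⟨⟨x, y⟩, b⟩
    cases b
    · rw [dd_h, hh]
    · rw [dd_v, hv]

lemma left_edge {f : Site → ℤ} (hf : (Function.support f).Finite) {x y : ℤ} (h : f (x, y) ≠ 0) :
    ∃ a < x, dd f ((a, y), false) ≠ 0 := by
  by_contra! hcon
  obtain ⟨N, hN⟩ := site_bound hf
  have hk : ∀ k : ℕ, f (x - k, y) = f (x, y) := by
    intro k
    induction k with
    | zero => simp
    | succ k ih =>
      have := hcon (x - (k + 1)) (by omega)
      rw [dd_h] at this
      rw [← ih]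
      have e : x - (k + 1 : ℤ) + 1 = x - k := by ring
      rw [e] at this
      push_cast
      linarith
  have h1 := hN (x - (N + 1 + x.natAbs : ℕ)) y (by rw [hk]; exact h)
  have := abs_cases (x - (N + 1 + x.natAbs : ℕ))
  omega

lemma right_edge {f : Site → ℤ} (hf : (Function.support f).Finite) {x y : ℤ} (h : f (x, y) ≠ 0) :
    ∃ a ≥ x, dd f ((a, y), false) ≠ 0 := by
  by_contra! hcon
  obtain ⟨N, hN⟩ := site_bound hf
  have hk : ∀ k : ℕ, f (x + k, y) = f (x, y) := by
    intro k
    induction k with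
    | zero => simp
    | succ k ih =>
      have := hcon (x + k) (by omega)
      rw [dd_h] at this
      rw [← ih]
      push_cast
      rw [← add_assoc]
      linarith
  have h1 := hN (x + (N + 1 + x.natAbs : ℕ)) y (by rw [hk]; exact h)
  have := abs_cases (x + (N + 1 + x.natAbs : ℕ))
  omega

/-- pointwise bound by the energy -/
lemma abs_le_HH {p : ℝ} (hp : 1 ≤ p) {f : Site → ℤ} (hf : (Function.support f).Finite) (x y : ℤ) :
    |(f (x, y) : ℝ)| ≤ HH p f := by
  obtain ⟨N, hN⟩ := site_bound hf
  let M : ℕ := N + 1 + x.natAbs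
  have hk : ∀ k : ℕ, f (x, y) - f (x - k, y) =
      ∑ i ∈ Finset.range k, dd f ((x - (i + 1), y), false) := by
    intro k
    induction k with
    | zero => simp
    | succ k ih =>
      rw [Finset.sum_range_succ, ← ih, dd_h]
      have e : x - (k + 1 : ℤ) + 1 = x - k := by ring
      rw [e]; push_cast; ring
  have h0 : f (x - M, y) = 0 := by
    by_contra h
    have h1 := hN _ _ h
    have := abs_cases (x - M)
    omega
  have h1 := hk M
  rw [h0, sub_zero] at h1
  rw [h1]
  push_cast
  refine (Finset.abs_sum_le_sum_abs _ _).trans ?_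
  have h2 : ∀ i ∈ Finset.range M, |((dd f ((x - (i + 1), y), false) : ℤ) : ℝ)| ≤
      |((dd f ((x - (i + 1), y), false) : ℤ) : ℝ)| ^ p := by
    intro i _
    set z := dd f ((x - (i + 1), y), false)
    by_cases hz : z = 0
    · simp [hz, Real.zero_rpow (by linarith : p ≠ 0)]
    · have : (1 : ℝ) ≤ |(z : ℝ)| := by
        rw [← Int.cast_abs]
        exact_mod_cast Int.one_le_abs hz
      calc |(z : ℝ)| = |(z : ℝ)| ^ (1 : ℝ) := by simp
        _ ≤ _ := Real.rpow_le_rpow_of_exponent_le this hp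
  refine (Finset.sum_le_sum h2).trans ?_
  have hinj : Function.Injective (fun i : ℕ => (((x - (i + 1), y), false) : Edge)) := by
    intro i j h
    simpa using h
  have := (HH_summable (by linarith : 0 < p) hf).sum_le_tsum
    ((Finset.range M).map ⟨_, hinj⟩) (fun e _ => Real.rpow_nonneg (abs_nonneg _) _)
  rw [Finset.sum_map] at this
  exact this

abbrev SEdge : Type := Edge × Bool

def sg (b : Bool) : ℤ := if b then 1 else -1

def Dset (f : Site → ℤ) : Set SEdge := {v | dd f v.1 = sg v.2}

lemma sg_ne (b : Bool) : sg b ≠ 0 := by cases b <;> simp [sg]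

lemma Dset_finite {f : Site → ℤ} (hf : (Function.support f).Finite) : (Dset f).Finite := by
  refine ((dd_finite hf).prod (Set.finite_univ (α := Bool))).subset ?_
  rintro ⟨e, b⟩ h
  refine ⟨?_, trivial⟩
  simp only [Dset, Set.mem_ofPred_eq] at h
  simp only [Function.mem_support, h]
  exact sg_ne b

def plaq (q : Site) : Finset Edge :=
  {(q, false), ((q.1, q.2 + 1), false), (q, true), ((q.1 + 1, q.2), true)}

def nbE (e : Edge) : Finset Edge :=
  plaq e.1 ∪ plaq (if e.2 then (e.1.1 - 1, e.1.2) else (e.1.1, e.1.2 - 1))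

def nbS (v : SEdge) : Finset SEdge := nbE v.1 ×ˢ Finset.univ

lemma mem_nbE (e e' : Edge) : e' ∈ nbE e ↔ ∃ q, e ∈ plaq q ∧ e' ∈ plaq q := by
  constructor
  · intro h
    simp only [nbE, Finset.mem_union] at h
    rcases h with h | h
    · refine ⟨_, ?_, h⟩
      obtain ⟨⟨x, y⟩, b⟩ := e
      cases b <;> simp [plaq]
    · refine ⟨_, ?_, h⟩
      obtain ⟨⟨x, y⟩, b⟩ := e
      cases b <;> simp [plaq]
  · rintro ⟨q, h1, h2⟩
    obtain ⟨⟨x, y⟩, b⟩ := e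
    obtain ⟨q1, q2⟩ := q
    simp only [nbE, Finset.mem_union]
    simp only [plaq, Finset.mem_insert, Finset.mem_singleton, Prod.mk.injEq] at h1
    rcases h1 with ⟨⟨rfl, rfl⟩, rfl⟩ | ⟨⟨rfl, rfl⟩, rfl⟩ | ⟨⟨rfl, rfl⟩, rfl⟩ | ⟨⟨rfl, rfl⟩, rfl⟩
    · exact Or.inl h2
    · right; simpa using h2
    · exact Or.inl h2
    · right; simpa using h2

lemma plaq_card (q : Site) : (plaq q).card ≤ 4 := Finset.card_le_four

lemma nbS_card (v : SEdge) : (nbS v).card ≤ 16 := by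
  simp only [nbS, Finset.card_product, Finset.card_univ, Fintype.card_bool]
  have := Finset.card_union_le (plaq v.1.1) (plaq (if v.1.2 then (v.1.1.1 - 1, v.1.1.2) else (v.1.1.1, v.1.1.2 - 1)))
  have h1 := plaq_card v.1.1
  have h2 := plaq_card (if v.1.2 then (v.1.1.1 - 1, v.1.1.2) else (v.1.1.1, v.1.1.2 - 1))
  simp only [nbE]
  omega

lemma nbS_symm (u v : SEdge) (h : v ∈ nbS u) : u ∈ nbS v := by
  simp only [nbS, Finset.mem_product, Finset.mem_univ, and_true, mem_nbE] at h ⊢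
  obtain ⟨q, h1, h2⟩ := h
  exact ⟨q, h2, h1⟩

lemma nbE_dist (e e' : Edge) (h : e' ∈ nbE e) :
    |e'.1.1 - e.1.1| ≤ 1 ∧ |e'.1.2 - e.1.2| ≤ 1 := by
  rw [mem_nbE] at h
  obtain ⟨⟨q1, q2⟩, h1, h2⟩ := h
  obtain ⟨⟨x, y⟩, b⟩ := e
  obtain ⟨⟨x', y'⟩, b'⟩ := e'
  simp only [plaq, Finset.mem_insert, Finset.mem_singleton, Prod.mk.injEq] at h1 h2
  simp only [abs_le]
  omega

lemma grown_dist {v0 : SEdge} {T : Finset SEdge} (h : Grown nbS v0 T) : ∀ v ∈ T,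
    |v.1.1.1 - v0.1.1.1| + 1 ≤ T.card ∧ |v.1.1.2 - v0.1.1.2| + 1 ≤ T.card := by
  induction h with
  | base => intro v hv; simp only [Finset.mem_singleton] at hv; simp [hv]
  | @step T u v _ hu hv hvT ih =>
    rw [Finset.card_insert_of_notMem hvT]
    intro z hz
    rw [Finset.mem_insert] at hz
    rcases hz with rfl | hz
    · have h1 := ih u hu
      simp only [nbS, Finset.mem_product, Finset.mem_univ, and_true] at hv
      have h2 := nbE_dist _ _ hv
      have h3 := abs_add_le (z.1.1.1 - u.1.1.1) (u.1.1.1 - v0.1.1.1)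
      have h4 := abs_add_le (z.1.1.2 - u.1.1.2) (u.1.1.2 - v0.1.1.2)
      rw [sub_add_sub_cancel] at h3 h4
      push_cast
      omega
    · have := ih z hz
      push_cast
      omega

structure IsC (f : Site → ℤ) : Prop where
  fin : (Function.support f).Finite
  pos : 0 < f (0, 0)
  unit : ∀ e, dd f e = 0 ∨ dd f e = 1 ∨ dd f e = -1
  conn : ∀ v0 ∈ Dset f, ∃ T : Finset SEdge, (T : Set SEdge) = Dset f ∧ Grown nbS v0 T

def len (f : Site → ℤ) : ℕ := (Dset f).ncard

/-- splitting off a component -/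
lemma split_comp {u : Site → ℤ} (hu : (Function.support u).Finite)
    (hunit : ∀ e, dd u e = 0 ∨ dd u e = 1 ∨ dd u e = -1) (C : Finset SEdge)
    (hCD : (C : Set SEdge) ⊆ Dset u)
    (hC : ∀ a ∈ C, ∀ v ∈ nbS a, v ∈ Dset u → v ∈ C) :
    ∃ f : Site → ℤ, (Function.support f).Finite ∧ (∀ e, (∃ s, (e, s) ∈ C) → dd f e = dd u e) ∧
      (∀ e, (¬ ∃ s, (e, s) ∈ C) → dd f e = 0) := by
  let w : Edge → ℤ := fun e => if (∃ s, (e, s) ∈ C) then dd u e else 0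
  have key : ∀ q e e', e ∈ plaq q → e' ∈ plaq q → (∃ s, (e, s) ∈ C) → w e' = dd u e' := by
    intro q e e' he he' ⟨s, hs⟩
    by_cases h0 : dd u e' = 0
    · simp [w, h0]
    · have : ∃ s', (e', s') ∈ Dset u := by
        rcases hunit e' with h | h | h
        · exact absurd h h0
        · exact ⟨true, by simpa [Dset, sg] using h⟩
        · exact ⟨false, by simpa [Dset, sg] using h⟩
      obtain ⟨s', hs'⟩ := this
      have : (e', s') ∈ C := by
        refine hC _ hs _ ?_ hs'
        simp only [nbS, Finset.mem_product, Finset.mem_univ, and_true, mem_nbE]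
        exact ⟨q, he, he'⟩
      have h2 : ∃ s, (e', s) ∈ C := ⟨s', this⟩
      simp only [w, h2, if_true]
  obtain ⟨f, hf, hfw⟩ := poincare w (by
    refine (dd_finite hu).subset ?_
    intro e he h0
    apply he
    simp [w, h0]) (by
    intro x y
    by_cases hex : ∃ e ∈ plaq (x, y), ∃ s, (e, s) ∈ C
    · obtain ⟨e, he, hs⟩ := hex
      rw [key (x, y) e _ he (by simp [plaq]) hs, key (x, y) e _ he (by simp [plaq]) hs,
        key (x, y) e _ he (by simp [plaq]) hs, key (x, y) e _ he (by simp [plaq]) hs]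
      simp only [dd_h, dd_v]
      ring
    · have hz : ∀ e ∈ plaq (x, y), w e = 0 := by
        intro e he
        have : ¬ ∃ s, (e, s) ∈ C := fun h => hex ⟨e, he, h⟩
        simp only [w, this, if_false]
      rw [hz _ (by simp [plaq]), hz _ (by simp [plaq]), hz _ (by simp [plaq]), hz _ (by simp [plaq])])
  refine ⟨f, hf, ?_, ?_⟩
  · intro e he
    rw [hfw]; simp only [w, he, if_true]
  · intro e he
    rw [hfw]; simp only [w, he, if_false]

lemma extract (n : ℕ) : ∀ u : Site → ℤ, (Function.support u).Finite →
    (∀ e, dd u e = 0 ∨ dd u e = 1 ∨ dd u e = -1) → 0 < u (0, 0) → (Dset u).ncard = n →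
    ∃ f, IsC f ∧ ∀ e, dd f e = dd u e ∨ dd f e = 0 := by
  induction n using Nat.strong_induction_on with
  | _ n ih =>
  intro u hu hunit hpos hn
  by_cases hcon : ∀ v0 ∈ Dset u, ∃ T : Finset SEdge, (T : Set SEdge) = Dset u ∧ Grown nbS v0 T
  · exact ⟨u, ⟨hu, hpos, hunit, hcon⟩, fun e => Or.inl rfl⟩
  push Not at hcon
  obtain ⟨v0, hv0, hT⟩ := hcon
  have hDfin := Dset_finite hu
  obtain ⟨C, hCg, hCD, hCcl⟩ := exists_comp nbS hDfin.toFinset v0 (by simpa using hv0)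
  have hCD' : (C : Set SEdge) ⊆ Dset u := by
    intro z hz
    simpa using hCD hz
  obtain ⟨f, hf, hf1, hf2⟩ := split_comp hu hunit C hCD' (by
    intro a ha v hv hvD
    exact hCcl a ha v hv (by simpa using hvD))
  have hsub : ∀ e, dd f e = dd u e ∨ dd f e = 0 := by
    intro e
    by_cases h : ∃ s, (e, s) ∈ C
    · exact Or.inl (hf1 e h)
    · exact Or.inr (hf2 e h)
  by_cases hfp : 0 < f (0, 0)
  · have hDf : Dset f = C := by
      ext ⟨e, s⟩
      simp only [Dset, Set.mem_ofPred_eq, Finset.mem_coe]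
      constructor
      · intro h
        by_cases hs : ∃ s, (e, s) ∈ C
        · obtain ⟨s', hs'⟩ := hs
          have h1 := hCD' hs'
          simp only [Dset, Set.mem_ofPred_eq] at h1
          rw [hf1 e ⟨s', hs'⟩, h1] at h
          have : s = s' := by cases s <;> cases s' <;> simp [sg] at h ⊢
          rwa [this]
        · rw [hf2 e hs] at h
          exact absurd h.symm (sg_ne s)
      · intro h
        rw [hf1 e ⟨s, h⟩]
        exact hCD' h
    have hlt : (Dset f).ncard < n := by
      rw [← hn]
      apply Set.ncard_lt_ncard _ hDfin
      refine ⟨hDf ▸ hCD', ?_⟩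
      intro hss
      exact hT C (Set.Subset.antisymm hCD' (hDf ▸ hss)) hCg
    obtain ⟨g, hg, hg2⟩ := ih _ hlt f hf (by
      intro e
      rcases hsub e with h | h
      · rw [h]; exact hunit e
      · exact Or.inl h) hfp rfl
    refine ⟨g, hg, ?_⟩
    intro e
    rcases hg2 e with h | h
    · rw [h]; exact hsub e
    · exact Or.inr h
  · have hsub' : ∀ e, dd (u - f) e = dd u e ∨ dd (u - f) e = 0 := by
      intro e
      rw [dd_sub]
      rcases hsub e with h | h
      · right; rw [h]; ring
      · left; rw [h]; ring
    have hfin' : (Function.support (u - f)).Finite := by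
      refine (hu.union hf).subset ?_
      exact Function.support_sub u f
    have hlt : (Dset (u - f)).ncard < n := by
      rw [← hn]
      apply Set.ncard_lt_ncard _ hDfin
      constructor
      · rintro ⟨e, s⟩ h
        simp only [Dset, Set.mem_ofPred_eq] at h ⊢
        rcases hsub' e with h' | h'
        · rw [← h', h]
        · rw [h'] at h; exact absurd h.symm (sg_ne s)
      · intro hss
        have h1 := hss hv0
        simp only [Dset, Set.mem_ofPred_eq] at h1
        rw [dd_sub, hf1 v0.1 ⟨v0.2, hCg.mem⟩, sub_self] at h1
        exact sg_ne _ h1.symm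
    obtain ⟨g, hg, hg2⟩ := ih _ hlt (u - f) hfin' (by
      intro e
      rcases hsub' e with h | h
      · rw [h]; exact hunit e
      · exact Or.inl h) (by simp only [Pi.sub_apply]; omega) rfl
    refine ⟨g, hg, ?_⟩
    intro e
    rcases hg2 e with h | h
    · rw [h]; exact hsub' e
    · exact Or.inr h

lemma IsC.signed {f : Site → ℤ} (hf : IsC f) {e : Edge} (he : dd f e ≠ 0) : ∃ s, (e, s) ∈ Dset f := by
  rcases hf.unit e with h | h | h
  · exact absurd h he
  · exact ⟨true, by simpa [Dset, sg] using h⟩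
  · exact ⟨false, by simpa [Dset, sg] using h⟩

lemma IsC.start {f : Site → ℤ} (hf : IsC f) : ∃ i : ℕ, i < len f ∧ ∃ s, ∃ T : Finset SEdge,
    (T : Set SEdge) = Dset f ∧ T.card = len f ∧ Grown nbS (((-((i : ℤ) + 1), 0), false), s) T := by
  obtain ⟨a, ha, hda⟩ := left_edge hf.fin hf.pos.ne'
  obtain ⟨b, hb, hdb⟩ := right_edge hf.fin hf.pos.ne'
  obtain ⟨s, hs⟩ := hf.signed hda
  obtain ⟨s', hs'⟩ := hf.signed hdb
  obtain ⟨T, hT, hg⟩ := hf.conn _ hs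
  have hcard : T.card = len f := by rw [len, ← hT, Set.ncard_coe_finset]
  have hbT : (((b, 0), false), s') ∈ T := by
    rw [← Finset.mem_coe, hT]; exact hs'
  have h1 := (grown_dist hg _ hbT).1
  simp only at h1
  have h2 := abs_cases (b - a)
  refine ⟨(-a - 1).toNat, by omega, s, T, hT, hcard, ?_⟩
  have : -(((-a - 1).toNat : ℤ) + 1) = a := by omega
  rw [this]
  exact hg

lemma IsC.box {f : Site → ℤ} (hf : IsC f) {x y : ℤ} (h : f (x, y) ≠ 0) :
    |x| ≤ 2 * len f ∧ |y| ≤ 2 * len f := by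
  obtain ⟨i, hi, s, T, hT, hcard, hg⟩ := hf.start
  obtain ⟨a, ha, hda⟩ := left_edge hf.fin h
  obtain ⟨b, hb, hdb⟩ := right_edge hf.fin h
  obtain ⟨s1, hs1⟩ := hf.signed hda
  obtain ⟨s2, hs2⟩ := hf.signed hdb
  rw [← hT, Finset.mem_coe] at hs1 hs2
  have h1 := grown_dist hg _ hs1
  have h2 := grown_dist hg _ hs2
  simp only [hcard] at h1 h2
  have e1 := abs_cases (a - (-((i : ℤ) + 1)))
  have e2 := abs_cases (b - (-((i : ℤ) + 1)))
  have e3 := abs_cases (y - 0)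
  have e4 := abs_cases x
  have e5 := abs_cases y
  constructor <;> omega

lemma IsC.HH_eq {p : ℝ} (hp : 0 < p) {f : Site → ℤ} (hf : IsC f) : HH p f = len f := by
  have hfin := dd_finite hf.fin
  have h1 : HH p f = ∑ e ∈ hfin.toFinset, |((dd f e : ℤ) : ℝ)| ^ p := by
    apply tsum_eq_sum
    intro e he
    have : dd f e = 0 := by simpa using he
    rw [this, Int.cast_zero]
    exact rp0 hp
  have h2 : ∀ e ∈ hfin.toFinset, |((dd f e : ℤ) : ℝ)| ^ p = 1 := by
    intro e he
    have h0 : dd f e ≠ 0 := by simpa using he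
    rcases hf.unit e with h | h | h
    · exact absurd h h0
    · simp [h]
    · simp [h]
  rw [h1, Finset.sum_congr rfl h2, Finset.sum_const, nsmul_eq_mul, mul_one]
  have h3 : Function.support (dd f) = Prod.fst '' Dset f := by
    ext e
    constructor
    · intro he
      obtain ⟨s, hs⟩ := hf.signed he
      exact ⟨_, hs, rfl⟩
    · rintro ⟨⟨e, s⟩, hs, rfl⟩
      simp only [Dset, Set.mem_ofPred_eq] at hs
      simp only [Function.mem_support, hs]
      exact sg_ne s
  have h4 : (Function.support (dd f)).ncard = (Dset f).ncard := by
    rw [h3]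
    apply Set.InjOn.ncard_image
    rintro ⟨e, s⟩ h ⟨e', s'⟩ h' hee
    simp only at hee
    subst hee
    simp only [Dset, Set.mem_ofPred_eq] at h h'
    rw [h] at h'
    have : s = s' := by cases s <;> cases s' <;> simp [sg] at h' ⊢
    rw [this]
  rw [len, ← h4, Set.ncard_eq_toFinset_card _ hfin]

lemma dd_inj {f g : Site → ℤ} (hf : (Function.support f).Finite) (hg : (Function.support g).Finite)
    (h : ∀ e, dd f e = dd g e) : f = g := by
  have hfg : (Function.support (f - g)).Finite := (hf.union hg).subset (Function.support_sub f g)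
  funext ⟨x, y⟩
  by_contra hne
  obtain ⟨a, _, ha⟩ := left_edge hfg (x := x) (y := y) (by
    simp only [Pi.sub_apply]; exact sub_ne_zero.mpr hne)
  rw [dd_sub, h, sub_self] at ha
  exact ha rfl

lemma IsC.ext' {f g : Site → ℤ} (hf : IsC f) (hg : IsC g) (h : Dset f = Dset g) : f = g := by
  apply dd_inj hf.fin hg.fin
  intro e
  by_cases h0 : dd f e = 0
  · rw [h0]
    by_contra h1
    obtain ⟨s, hs⟩ := hg.signed (Ne.symm h1)
    rw [← h] at hs
    simp only [Dset, Set.mem_ofPred_eq, h0] at hs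
    exact sg_ne s hs.symm
  · obtain ⟨s, hs⟩ := hf.signed h0
    have hs' := hs
    rw [h] at hs'
    simp only [Dset, Set.mem_ofPred_eq] at hs hs'
    rw [hs, hs']

abbrev CF : Type := {f : Site → ℤ // IsC f}

open scoped ENNReal

def wt (b : ℝ) (f : Site → ℤ) : ℝ≥0∞ := ENNReal.ofReal (Real.exp (-b * len f))

lemma peierls_sum {b : ℝ} (hb : 10 ≤ b) : ∑' f : CF, wt b f.1 ≤ ENNReal.ofReal (1 / 4) := by
  set z : ℝ := Real.exp (-b) with hz
  have hz0 : 0 ≤ z := (Real.exp_pos _).le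
  have hz1 : z ≤ 1 / 8192 := by
    have h1 : (2.7 : ℝ) ≤ Real.exp 1 := by linarith [Real.exp_one_gt_d9]
    have h2 : (8192 : ℝ) ≤ Real.exp 10 := by
      have : Real.exp 10 = Real.exp 1 ^ 10 := by rw [← Real.exp_nat_mul]; norm_num
      rw [this]
      calc (8192 : ℝ) ≤ 2.7 ^ 10 := by norm_num
        _ ≤ _ := pow_le_pow_left₀ (by norm_num) h1 10
    calc z ≤ Real.exp (-10) := Real.exp_le_exp.mpr (by linarith)
      _ = (Real.exp 10)⁻¹ := Real.exp_neg _
      _ ≤ 1 / 8192 := by rw [one_div]; exact inv_anti₀ (by norm_num) h2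
  let st : ℕ → Bool → SEdge := fun i s => (((-((i : ℤ) + 1), 0), false), s)
  let G : ℕ → ℕ → Bool → Finset SEdge → ℝ≥0∞ := fun n i s T =>
    if Grown nbS (st i s) T ∧ T.card = n + 1 then ENNReal.ofReal (z ^ (n + 1)) else 0
  let Tf : CF → Finset SEdge := fun f => (Dset_finite f.2.fin).toFinset
  have hinj : Function.Injective Tf := by
    intro f g h
    apply Subtype.ext
    apply f.2.ext' g.2
    have := congrArg (fun T : Finset SEdge => (T : Set SEdge)) h
    simpa [Tf] using this
  have hstep1 : ∀ f : CF, wt b f.1 ≤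
      ∑' n, ∑ i ∈ Finset.range (n + 1), ∑ s : Bool, G n i s (Tf f) := by
    intro f
    obtain ⟨i, hi, s, T, hT, hcard, hg⟩ := f.2.start
    have hTf : Tf f = T := by
      apply Finset.coe_injective
      simp only [Tf, Set.Finite.coe_toFinset, hT]
    have hG : G (len f.1 - 1) i s (Tf f) = wt b f.1 := by
      have h1 : len f.1 - 1 + 1 = len f.1 := by omega
      have h2 : Grown nbS (st i s) T ∧ T.card = len f.1 - 1 + 1 := ⟨hg, by omega⟩
      simp only [G, hTf, h2, and_self, if_true, wt]
      congr 1
      rw [h1, hz, ← Real.exp_nat_mul]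
      congr 1; ring
    calc wt b f.1 = G (len f.1 - 1) i s (Tf f) := hG.symm
      _ ≤ ∑ s : Bool, G (len f.1 - 1) i s (Tf f) :=
          Finset.single_le_sum (f := fun s => G (len f.1 - 1) i s (Tf f)) (fun _ _ => zero_le) (Finset.mem_univ s)
      _ ≤ ∑ i ∈ Finset.range (len f.1 - 1 + 1), ∑ s : Bool, G (len f.1 - 1) i s (Tf f) :=
          Finset.single_le_sum (f := fun i => ∑ s : Bool, G (len f.1 - 1) i s (Tf f))
            (fun _ _ => zero_le) (by rw [Finset.mem_range]; omega)
      _ ≤ _ := ENNReal.le_tsum (f := fun n => ∑ i ∈ Finset.range (n + 1), ∑ s : Bool, G n i s (Tf f)) (len f.1 - 1)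
  have hG2 : ∀ n i s, ∑' T, G n i s T ≤ ENNReal.ofReal (256 ^ (n + 1) * z ^ (n + 1)) := by
    intro n i s
    obtain ⟨S, hS, hcard⟩ := grown_count nbS_symm 16 (by norm_num) nbS_card (st i s) (n + 1)
    calc ∑' T, G n i s T ≤ ∑' T, (if T ∈ S then ENNReal.ofReal (z ^ (n + 1)) else 0) := by
          apply ENNReal.tsum_le_tsum
          intro T
          by_cases h : Grown nbS (st i s) T ∧ T.card = n + 1
          · have : T ∈ S := hS T h.1 h.2
            simp [G, h, this]
          · simp [G, h]
      _ = ∑ T ∈ S, ENNReal.ofReal (z ^ (n + 1)) := by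
          rw [tsum_eq_sum (s := S)]
          · apply Finset.sum_congr rfl
            intro T hT
            simp [hT]
          · intro T hT
            simp [hT]
      _ = ENNReal.ofReal (S.card * z ^ (n + 1)) := by
          rw [Finset.sum_const, ENNReal.ofReal_mul (by positivity), nsmul_eq_mul]
          simp
      _ ≤ _ := by
          apply ENNReal.ofReal_le_ofReal
          apply mul_le_mul_of_nonneg_right _ (by positivity)
          calc (S.card : ℝ) ≤ ((16 ^ (2 * (n + 1)) : ℕ) : ℝ) := by exact_mod_cast hcard
            _ = 256 ^ (n + 1) := by push_cast; rw [pow_mul]; norm_num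
  calc ∑' f : CF, wt b f.1
      ≤ ∑' f : CF, ∑' n, ∑ i ∈ Finset.range (n + 1), ∑ s : Bool, G n i s (Tf f) :=
        ENNReal.tsum_le_tsum hstep1
    _ ≤ ∑' T, ∑' n, ∑ i ∈ Finset.range (n + 1), ∑ s : Bool, G n i s T :=
        ENNReal.tsum_comp_le_tsum_of_injective hinj
          (fun T => ∑' n, ∑ i ∈ Finset.range (n + 1), ∑ s : Bool, G n i s T)
    _ = ∑' n, ∑ i ∈ Finset.range (n + 1), ∑ s : Bool, ∑' T, G n i s T := by
        rw [ENNReal.tsum_comm]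
        apply tsum_congr
        intro n
        rw [Summable.tsum_finsetSum (fun _ _ => ENNReal.summable)]
        apply Finset.sum_congr rfl
        intro i _
        rw [Summable.tsum_finsetSum (fun _ _ => ENNReal.summable)]
    _ ≤ ∑' n : ℕ, ENNReal.ofReal ((1 / 8) * (1 / 2) ^ n) := by
        apply ENNReal.tsum_le_tsum
        intro n
        calc ∑ i ∈ Finset.range (n + 1), ∑ s : Bool, ∑' T, G n i s T
            ≤ ∑ i ∈ Finset.range (n + 1), ∑ s : Bool, ENNReal.ofReal (256 ^ (n + 1) * z ^ (n + 1)) :=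
              Finset.sum_le_sum fun i _ => Finset.sum_le_sum fun s _ => hG2 n i s
          _ = ENNReal.ofReal ((n + 1 : ℕ) * (2 * (256 ^ (n + 1) * z ^ (n + 1)))) := by
              generalize 256 ^ (n + 1) * z ^ (n + 1) = X
              rw [ENNReal.ofReal_mul (p := ((n + 1 : ℕ) : ℝ)) (by positivity),
                ENNReal.ofReal_mul (p := 2) (by norm_num), ENNReal.ofReal_natCast]
              simp
          _ ≤ _ := by
              apply ENNReal.ofReal_le_ofReal
              have h1 : ((n + 1 : ℕ) : ℝ) ≤ 2 ^ (n + 1) := by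
                exact_mod_cast (Nat.lt_two_pow_self).le
              calc ((n + 1 : ℕ) : ℝ) * (2 * (256 ^ (n + 1) * z ^ (n + 1)))
                  ≤ 2 ^ (n + 1) * (2 * (256 ^ (n + 1) * (1 / 8192) ^ (n + 1))) := by gcongr
                _ = 2 * ((2 * 256 * (1 / 8192)) ^ (n + 1)) := by rw [mul_pow, mul_pow]; ring
                _ = 1 / 8 * (1 / 16) ^ n := by rw [pow_succ]; norm_num; ring
                _ ≤ _ := by
                  gcongr
                  norm_num
    _ = ENNReal.ofReal (1 / 4) := by
        rw [← ENNReal.ofReal_tsum_of_nonneg]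
        · rw [tsum_mul_left, tsum_geometric_two]; norm_num
        · intro n; positivity
        · exact summable_geometric_two.mul_left _

lemma superadd {ι : Type} {p : ℝ} (hp : 1 ≤ p) (s : Finset ι) (c : ι → ℝ) (hc : ∀ i ∈ s, 0 ≤ c i)
    (a : ℝ) (ha : 0 ≤ a) : a ^ p + ∑ i ∈ s, c i ^ p ≤ (a + ∑ i ∈ s, c i) ^ p := by
  classical
  induction s using Finset.induction_on with
  | empty => simp
  | insert i s hi ih =>
    rw [Finset.sum_insert hi, Finset.sum_insert hi]
    have h1 := ih (fun j hj => hc j (Finset.mem_insert_of_mem hj))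
    have h0 : 0 ≤ a + ∑ i ∈ s, c i :=
      add_nonneg ha (Finset.sum_nonneg fun j hj => hc j (Finset.mem_insert_of_mem hj))
    have h2 := Real.add_rpow_le_rpow_add h0 (hc i (Finset.mem_insert_self _ _)) hp
    have e : a + (c i + ∑ i ∈ s, c i) = a + ∑ i ∈ s, c i + c i := by ring
    rw [e]
    linarith

def Compat {h : ℕ} (η : Site → ℤ) (F : Fin h → Site → ℤ) : Prop :=
  ∀ e, (0 ≤ dd η e ∧ (∀ k, 0 ≤ dd (F k) e) ∧ ∑ k, dd (F k) e ≤ dd η e) ∨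
    (dd η e ≤ 0 ∧ (∀ k, dd (F k) e ≤ 0) ∧ dd η e ≤ ∑ k, dd (F k) e)

lemma supp_sum_finite {ι : Type} (s : Finset ι) (F : ι → Site → ℤ)
    (hF : ∀ k ∈ s, (Function.support (F k)).Finite) :
    (Function.support (∑ k ∈ s, F k)).Finite := by
  refine (s.finite_toSet.biUnion hF).subset ?_
  intro x hx
  simp only [Function.mem_support, Finset.sum_apply] at hx
  obtain ⟨k, hk, hk'⟩ := Finset.exists_ne_zero_of_sum_ne_zero hx
  simp only [Set.mem_iUnion]
  exact ⟨k, hk, hk'⟩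

lemma edge_ineq {h : ℕ} {p : ℝ} (hp : 1 ≤ p) (a : ℤ) (c : Fin h → ℤ) (K : Finset (Fin h))
    (hc : ∀ k, 0 ≤ c k) (hs : ∑ k, c k ≤ a) :
    |((a - ∑ k, c k : ℤ) : ℝ)| ^ p + |((∑ k ∈ Kᶜ, c k : ℤ) : ℝ)| ^ p + ∑ k ∈ K, |(c k : ℝ)| ^ p ≤
      |(a : ℝ)| ^ p := by
  have h0 : 0 ≤ ∑ k ∈ Kᶜ, c k := Finset.sum_nonneg fun k _ => hc k
  have h1 : 0 ≤ ∑ k, c k := Finset.sum_nonneg fun k _ => hc k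
  have hsplit : ∑ k, c k = ∑ k ∈ K, c k + ∑ k ∈ Kᶜ, c k := (Finset.sum_add_sum_compl K c).symm
  rw [abs_of_nonneg (by exact_mod_cast (by omega : 0 ≤ a - ∑ k, c k)), abs_of_nonneg (by exact_mod_cast h0),
    abs_of_nonneg (by exact_mod_cast (by omega : 0 ≤ a))]
  have h2 : ∑ k ∈ K, |(c k : ℝ)| ^ p = ∑ k ∈ K, (c k : ℝ) ^ p :=
    Finset.sum_congr rfl fun k _ => by rw [abs_of_nonneg (by exact_mod_cast hc k)]
  rw [h2]
  set A : ℝ := ((a - ∑ k, c k : ℤ) : ℝ) with hA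
  set B : ℝ := ((∑ k ∈ Kᶜ, c k : ℤ) : ℝ) with hB
  have hA0 : 0 ≤ A := by rw [hA]; exact_mod_cast (by omega : 0 ≤ a - ∑ k, c k)
  have hB0 : 0 ≤ B := by rw [hB]; exact_mod_cast h0
  have h3 := Real.add_rpow_le_rpow_add hA0 hB0 hp
  have h4 := superadd hp K (fun k => (c k : ℝ)) (fun k _ => by exact_mod_cast hc k) (A + B) (by linarith)
  have h5 : (a : ℝ) = A + B + ∑ k ∈ K, (c k : ℝ) := by
    rw [hA, hB, hsplit]; push_cast; ring
  rw [h5]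
  linarith

lemma energy_split {h : ℕ} {p : ℝ} (hp : 1 ≤ p) {η : Site → ℤ} {F : Fin h → Site → ℤ}
    (hη : (Function.support η).Finite) (hF : ∀ k, (Function.support (F k)).Finite)
    (hc : Compat η F) (K : Finset (Fin h)) :
    HH p (η - ∑ k, F k) + HH p (∑ k ∈ Kᶜ, F k) + ∑ k ∈ K, HH p (F k) ≤ HH p η := by
  have hp0 : 0 < p := by linarith
  have s1 := HH_summable (η := η - ∑ k, F k) hp0 (((hη.union (supp_sum_finite Finset.univ F (fun k _ => hF k))).subset
    (Function.support_sub η (∑ k, F k))))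
  have s2 := HH_summable hp0 (supp_sum_finite Kᶜ F (fun k _ => hF k))
  have s3 : ∀ k ∈ K, Summable (fun e : Edge => |((dd (F k) e : ℤ) : ℝ)| ^ p) :=
    fun k _ => HH_summable hp0 (hF k)
  unfold HH
  rw [← Summable.tsum_finsetSum s3, ← s1.tsum_add s2, ← (s1.add s2).tsum_add (summable_sum s3)]
  refine ((s1.add s2).add (summable_sum s3)).tsum_le_tsum ?_ (HH_summable hp0 hη)
  intro e
  simp only [dd_sub, dd_sum]
  rcases hc e with ⟨_, h2, h3⟩ | ⟨_, h2, h3⟩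
  · exact edge_ineq hp _ _ K h2 h3
  · have := edge_ineq hp (-dd η e) (fun k => - dd (F k) e) K (fun k => by simpa using h2 k)
      (by rw [Finset.sum_neg_distrib]; omega)
    simp only [Finset.sum_neg_distrib] at this
    rw [← neg_sub', Int.cast_neg, Int.cast_neg, Int.cast_neg, abs_neg, abs_neg, abs_neg] at this
    simpa only [Int.cast_neg, abs_neg] using this

lemma clamp_sum (h : ℕ) (z : ℤ) :
    ∑ k : Fin h, (if ((k : ℕ) : ℤ) + 1 ≤ z then (1 : ℤ) else 0) = max 0 (min (h : ℤ) z) := by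
  induction h with
  | zero => simp
  | succ h ih =>
    rw [Fin.sum_univ_castSucc]
    simp only [Fin.val_castSucc, Fin.val_last, ih]
    split_ifs <;> push_cast <;> omega

lemma levels (h : ℕ) {η : Site → ℤ} (hη : (Function.support η).Finite) (h0 : (h : ℤ) ≤ η (0, 0)) :
    ∃ F : Fin h → Site → ℤ, (∀ k, IsC (F k)) ∧ Compat η F := by
  let u : Fin h → Site → ℤ := fun k x => if ((k : ℕ) : ℤ) + 1 ≤ η x then 1 else 0
  have hu : ∀ k, ∃ f, IsC f ∧ ∀ e, dd f e = dd (u k) e ∨ dd f e = 0 := by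
    intro k
    refine extract _ (u k) ?_ ?_ ?_ rfl
    · refine hη.subset ?_
      intro x hx hx0
      apply hx
      simp only [u, hx0]
      rw [if_neg (by omega)]
    · intro e
      simp only [dd, u]
      split_ifs <;> simp
    · have := k.2
      simp only [u]
      rw [if_pos (by omega)]
      norm_num
  choose F hF1 hF2 using hu
  refine ⟨F, hF1, ?_⟩
  intro e
  have hsum : ∑ k, dd (u k) e = max 0 (min (h : ℤ) (η (tgt e))) - max 0 (min (h : ℤ) (η e.1)) := by
    simp only [dd, Finset.sum_sub_distrib, u, clamp_sum]
  rcases le_total 0 (dd η e) with hd | hd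
  · left
    have hu0 : ∀ k, 0 ≤ dd (u k) e := by
      intro k
      simp only [dd, u] at hd ⊢
      split_ifs <;> omega
    have hle : ∀ k, dd (F k) e ≤ dd (u k) e := by
      intro k
      have := hu0 k
      rcases hF2 k e with h | h <;> omega
    refine ⟨hd, ?_, ?_⟩
    · intro k
      have := hu0 k
      rcases hF2 k e with h | h <;> omega
    · refine (Finset.sum_le_sum fun k _ => hle k).trans ?_
      rw [hsum]
      simp only [dd] at hd ⊢
      omega
  · right
    have hu0 : ∀ k, dd (u k) e ≤ 0 := by
      intro k
      simp only [dd, u] at hd ⊢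
      split_ifs <;> omega
    have hle : ∀ k, dd (u k) e ≤ dd (F k) e := by
      intro k
      have := hu0 k
      rcases hF2 k e with h | h <;> omega
    refine ⟨hd, ?_, ?_⟩
    · intro k
      have := hu0 k
      rcases hF2 k e with h | h <;> omega
    · refine le_trans ?_ (Finset.sum_le_sum fun k _ => hle k)
      rw [hsum]
      simp only [dd] at hd ⊢
      omega

/-- row convexity -/
def RowC (Λ : Finset Site) : Prop :=
  ∀ a x b y : ℤ, a ≤ x → x ≤ b → (a, y) ∈ Λ → (b, y) ∈ Λ → (x, y) ∈ Λ

lemma ball_rowC (r : ℝ) : RowC (ball r) := by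
  intro a x b y hax hxb ha hb
  simp only [ball, Finset.mem_filter, Finset.mem_product, Finset.mem_Icc] at ha hb ⊢
  refine ⟨⟨⟨ha.1.1.1.trans hax, hxb.trans hb.1.1.2⟩, ha.1.2⟩, ?_⟩
  have h1 : (a : ℝ) ≤ x := by exact_mod_cast hax
  have h2 : (x : ℝ) ≤ b := by exact_mod_cast hxb
  rcases le_total 0 (x : ℝ) with h | h
  · nlinarith [ha.2, hb.2]
  · nlinarith [ha.2, hb.2]

lemma compat_supp {h : ℕ} {η : Site → ℤ} {F : Fin h → Site → ℤ} (hF : ∀ k, IsC (F k))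
    (hc : Compat η F) {Λ : Finset Site} (hΛ : RowC Λ) (hη : ∀ x ∉ Λ, η x = 0) (k : Fin h) :
    ∀ x ∉ Λ, F k x = 0 := by
  rintro ⟨x, y⟩ hx
  by_contra hne
  have key : ∀ e, dd (F k) e ≠ 0 → dd η e ≠ 0 := by
    intro e he h0
    rcases hc e with ⟨_, h2, h3⟩ | ⟨_, h2, h3⟩
    · have := Finset.single_le_sum (f := fun k => dd (F k) e) (fun k _ => h2 k) (Finset.mem_univ k)
      have := h2 k
      omega
    · have := Finset.single_le_sum (f := fun k => - dd (F k) e) (fun k _ => by simpa using h2 k) (Finset.mem_univ k)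
      rw [Finset.sum_neg_distrib] at this
      have := h2 k
      omega
  have key2 : ∀ a, dd η ((a, y), false) ≠ 0 → (a, y) ∈ Λ ∨ (a + 1, y) ∈ Λ := by
    intro a ha
    by_contra! hcon
    apply ha
    rw [dd_h, hη _ hcon.1, hη _ hcon.2, sub_self]
  obtain ⟨a, hax, ha⟩ := left_edge (hF k).fin hne
  obtain ⟨b, hbx, hb⟩ := right_edge (hF k).fin hne
  have h1 := key2 a (key _ ha)
  have h2 := key2 b (key _ hb)
  apply hx
  rcases h1 with h1 | h1 <;> rcases h2 with h2 | h2
  · exact hΛ _ _ _ _ (by omega) (by omega) h1 h2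
  · exact hΛ _ _ _ _ (by omega) (by omega) h1 h2
  · exact hΛ _ _ _ _ (by omega) (by omega) h1 h2
  · exact hΛ _ _ _ _ (by omega) (by omega) h1 h2

lemma Estar_nonneg {p : ℝ} : 0 ≤ Estar p := by
  apply Real.sInf_nonneg
  rintro E ⟨φ, _, _, rfl⟩
  unfold pDir
  refine mul_nonneg (by norm_num) (tsum_nonneg fun pr => ?_)
  split_ifs
  · exact Real.rpow_nonneg (abs_nonneg _) _
  · exact le_rfl

lemma Estar_le {p : ℝ} {φ : Site → ℝ} (hφ : (Function.support φ).Finite) (h1 : φ (0, 0) = 1) :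
    Estar p ≤ pDir p φ := by
  apply csInf_le
  · refine ⟨0, ?_⟩
    rintro E ⟨φ, _, _, rfl⟩
    unfold pDir
    refine mul_nonneg (by norm_num) (tsum_nonneg fun pr => ?_)
    split_ifs
    · exact Real.rpow_nonneg (abs_nonneg _) _
    · exact le_rfl
  · exact ⟨φ, hφ, h1, rfl⟩

lemma HH_ge {p : ℝ} (hp : 0 < p) {ψ : Site → ℤ} (hψ : (Function.support ψ).Finite) (m : ℝ)
    (hm : 0 ≤ m) (h : m ≤ ψ (0, 0)) : Estar p * m ^ p ≤ HH p ψ := by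
  rcases hm.eq_or_lt with rfl | hm0
  · rw [Real.zero_rpow hp.ne', mul_zero]; exact HH_nonneg _ _
  set q : ℝ := ((ψ (0, 0) : ℤ) : ℝ) with hq
  have hq0 : 0 < q := lt_of_lt_of_le hm0 h
  have hfin : (Function.support (fun x => (ψ x : ℝ) / q)).Finite := by
    refine hψ.subset ?_
    intro x hx hx0
    exact hx (by simp [hx0])
  have h1 := Estar_le (p := p) hfin (by simp only [← hq]; field_simp)
  have h2 : pDir p (fun x => (ψ x : ℝ) / q) = HH p ψ / q ^ p := by
    rw [pDir_eq hp hfin, HH, ← tsum_div_const]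
    apply tsum_congr
    intro e
    have : dd (fun x => (ψ x : ℝ) / q) e = ((dd ψ e : ℤ) : ℝ) / q := by
      simp only [dd]; push_cast; ring
    rw [this, abs_div, abs_of_pos hq0, Real.div_rpow (abs_nonneg _) hq0.le]
  rw [h2, le_div_iff₀ (Real.rpow_pos_of_pos hq0 p)] at h1
  refine le_trans ?_ h1
  exact mul_le_mul_of_nonneg_left (Real.rpow_le_rpow hm h hp.le) Estar_nonneg

open scoped ENNReal

def ew (p β : ℝ) (η : Site → ℤ) : ℝ≥0∞ := ENNReal.ofReal (Real.exp (-β * HH p η))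

def WE (p β : ℝ) (Λ : Finset Site) (A : (Site → ℤ) → Prop) : ℝ≥0∞ :=
  ∑' η : Site → ℤ, if (∀ x ∉ Λ, η x = 0) ∧ A η then ew p β η else 0

lemma WE_sub (p β : ℝ) (Λ : Finset Site) (A : (Site → ℤ) → Prop) :
    WE p β Λ A = ∑' η : {η : Site → ℤ // (∀ x ∉ Λ, η x = 0) ∧ A η}, ew p β η.1 := by
  unfold WE
  rw [← (Subtype.val_injective (p := fun η : Site → ℤ => (∀ x ∉ Λ, η x = 0) ∧ A η)).tsum_eq]
  · apply tsum_congr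
    intro η
    rw [if_pos η.2]
  · intro η hη
    simp only [Function.mem_support] at hη
    by_cases h : (∀ x ∉ Λ, η x = 0) ∧ A η
    · exact ⟨⟨η, h⟩, rfl⟩
    · rw [if_neg h] at hη; exact absurd rfl hη

lemma off_fin {Λ : Finset Site} {η : Site → ℤ} (h : ∀ x ∉ Λ, η x = 0) :
    (Function.support η).Finite := by
  refine Λ.finite_toSet.subset ?_
  intro x hx
  by_contra hx'
  exact hx (h x hx')

lemma pW_eq {p : ℝ} (hp : 0 < p) (β : ℝ) (Λ : Finset Site) (A : (Site → ℤ) → Prop) :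
    pW p β Λ A = (WE p β Λ A).toReal := by
  unfold pW WE
  rw [ENNReal.tsum_toReal_eq]
  · apply tsum_congr
    intro η
    by_cases h : (∀ x ∉ Λ, η x = 0) ∧ A η
    · rw [if_pos h, if_pos h, ew, ENNReal.toReal_ofReal (Real.exp_pos _).le, pH_eq hp (off_fin h.1)]
    · rw [if_neg h, if_neg h]; simp
  · intro η
    split_ifs
    · exact ENNReal.ofReal_ne_top
    · simp

lemma tsum_pi_fin {α : Type} (g : α → ℝ≥0∞) (n : ℕ) :
    ∑' f : Fin n → α, ∏ i, g (f i) = (∑' a, g a) ^ n := by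
  induction n with
  | zero => simp [tsum_fintype]
  | succ n ih =>
    rw [← (Fin.consEquiv (fun _ : Fin (n + 1) => α)).tsum_eq, ENNReal.tsum_prod', pow_succ',
      ← ENNReal.tsum_mul_right]
    apply tsum_congr
    intro a
    rw [← ih, ← ENNReal.tsum_mul_left]
    apply tsum_congr
    intro f
    rw [Fin.prod_univ_succ]
    simp [Fin.consEquiv]

lemma tsum_opt {α : Type} (g : Option α → ℝ≥0∞) : ∑' o, g o = g none + ∑' a, g (some a) := by
  rw [← (Equiv.optionEquivSumPUnit.{0, 0} α).symm.tsum_eq, Summable.tsum_sum ENNReal.summable ENNReal.summable]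
  simp [add_comm, tsum_fintype]

lemma int_sum_ne_top {c : ℝ} (hc : 0 < c) :
    ∑' k : ℤ, ENNReal.ofReal (Real.exp (-c * |(k : ℝ)|)) ≠ ∞ := by
  have hg : Summable (fun n : ℕ => Real.exp (-c * n)) := by
    have : ∀ n : ℕ, Real.exp (-c * n) = Real.exp (-c) ^ n := by
      intro n; rw [← Real.exp_nat_mul]; ring_nf
    simp_rw [this]
    apply summable_geometric_of_lt_one (Real.exp_pos _).le
    rw [Real.exp_lt_one_iff]; linarith
  have hs : Summable (fun k : ℤ => Real.exp (-c * |(k : ℝ)|)) := by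
    apply Summable.of_nat_of_neg
    · simpa using hg
    · simpa using hg
  rw [← ENNReal.ofReal_tsum_of_nonneg (fun _ => (Real.exp_pos _).le) hs]
  exact ENNReal.ofReal_ne_top

lemma WE_ne_top {p : ℝ} (hp : 1 ≤ p) {β : ℝ} (hβ : 0 < β) (Λ : Finset Site)
    (A : (Site → ℤ) → Prop) : WE p β Λ A ≠ ∞ := by
  obtain ⟨c, hc⟩ : ∃ c : ℝ, c = β / (Λ.card + 1) := ⟨_, rfl⟩
  have hc0 : 0 < c := by rw [hc]; positivity
  let eq := Λ.equivFin
  have h1 : WE p β Λ A ≤ ∑' f : Fin Λ.card → ℤ, ∏ i, ENNReal.ofReal (Real.exp (-c * |((f i : ℤ) : ℝ)|)) := by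
    rw [WE_sub]
    let Φ : {η : Site → ℤ // (∀ x ∉ Λ, η x = 0) ∧ A η} → (Fin Λ.card → ℤ) :=
      fun η i => η.1 (eq.symm i).1
    have hΦ : Function.Injective Φ := by
      intro η ξ h
      apply Subtype.ext
      funext x
      by_cases hx : x ∈ Λ
      · have := congrFun h (eq ⟨x, hx⟩)
        simpa [Φ] using this
      · rw [η.2.1 x hx, ξ.2.1 x hx]
    refine le_trans (ENNReal.tsum_le_tsum ?_) (ENNReal.tsum_comp_le_tsum_of_injective hΦ _)
    intro η
    rw [← ENNReal.ofReal_prod_of_nonneg (fun _ _ => (Real.exp_pos _).le), ← Real.exp_sum, ew]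
    apply ENNReal.ofReal_le_ofReal
    apply Real.exp_le_exp.mpr
    have hH := HH_nonneg p η.1
    have : ∑ i, (-c * |((Φ η i : ℤ) : ℝ)|) ≥ ∑ i : Fin Λ.card, (-c * HH p η.1) := by
      apply Finset.sum_le_sum
      intro i _
      have := abs_le_HH hp (off_fin η.2.1) (eq.symm i).1.1 (eq.symm i).1.2
      have h3 : |((Φ η i : ℤ) : ℝ)| ≤ HH p η.1 := this
      nlinarith
    refine le_trans ?_ this
    rw [Finset.sum_const, Finset.card_univ, Fintype.card_fin, nsmul_eq_mul]
    have h4 : β = c * (Λ.card + 1) := by rw [hc]; field_simp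
    have h5 : 0 ≤ c * HH p η.1 := by positivity
    have h6 : β * HH p η.1 = c * HH p η.1 * Λ.card + c * HH p η.1 := by rw [h4]; ring
    linarith
  rw [tsum_pi_fin (fun k : ℤ => ENNReal.ofReal (Real.exp (-c * |(k : ℝ)|)))] at h1
  exact ne_top_of_le_ne_top (ENNReal.pow_ne_top (int_sum_ne_top hc0)) h1

lemma WE_pos (p β : ℝ) (Λ : Finset Site) : 0 < WE p β Λ (fun _ => True) := by
  refine lt_of_lt_of_le ?_ (ENNReal.le_tsum (0 : Site → ℤ))
  rw [if_pos ⟨fun _ _ => rfl, trivial⟩, ew]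
  exact ENNReal.ofReal_pos.mpr (Real.exp_pos _)

lemma HH_neg (p : ℝ) (η : Site → ℤ) : HH p (-η) = HH p η := by
  simp only [HH, dd_neg, Int.cast_neg, abs_neg]

lemma peierls_pos {p : ℝ} (hp : 1 ≤ p) {β : ℝ} (hβ : 10 ≤ β) {Λ : Finset Site} (hΛ : RowC Λ) :
    WE p β Λ (fun η => 1 ≤ η (0, 0)) ≤ ENNReal.ofReal (1 / 4) * WE p β Λ (fun _ => True) := by
  have hlev : ∀ η : {η : Site → ℤ // (∀ x ∉ Λ, η x = 0) ∧ 1 ≤ η (0, 0)}, ∃ f : CF,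
      (∀ x ∉ Λ, f.1 x = 0) ∧ HH p (η.1 - f.1) + len f.1 ≤ HH p η.1 := by
    intro η
    obtain ⟨F, hF, hc⟩ := levels 1 (off_fin η.2.1) (by simpa using η.2.2)
    refine ⟨⟨F 0, hF 0⟩, compat_supp hF hc hΛ η.2.1 0, ?_⟩
    have := energy_split hp (off_fin η.2.1) (fun k => (hF k).fin) hc Finset.univ
    simp only [Fin.sum_univ_one, Finset.univ_unique, Fin.default_eq_zero, Finset.sum_singleton] at this
    rw [(hF 0).HH_eq (by linarith)] at this
    have h2 := HH_nonneg p (∑ k ∈ ({0} : Finset (Fin 1))ᶜ, F k)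
    simp only
    linarith
  choose f hf1 hf2 using hlev
  rw [WE_sub p β Λ (fun _ => True)]
  calc WE p β Λ (fun η => 1 ≤ η (0, 0))
      ≤ ∑' c : CF × {η : Site → ℤ // (∀ x ∉ Λ, η x = 0) ∧ True}, wt β c.1.1 * ew p β c.2.1 := by
        rw [WE_sub]
        let Φ : {η : Site → ℤ // (∀ x ∉ Λ, η x = 0) ∧ 1 ≤ η (0, 0)} →
            CF × {η : Site → ℤ // (∀ x ∉ Λ, η x = 0) ∧ True} :=
          fun η => (f η, ⟨η.1 - (f η).1, fun x hx => by
            simp only [Pi.sub_apply, η.2.1 x hx, hf1 η x hx, sub_self], trivial⟩)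
        have hΦ : Function.Injective Φ := by
          intro η ξ h
          simp only [Φ, Prod.mk.injEq, Subtype.mk.injEq] at h
          apply Subtype.ext
          have h2 := h.2
          rw [h.1] at h2
          exact sub_left_injective h2
        refine le_trans (ENNReal.tsum_le_tsum ?_) (ENNReal.tsum_comp_le_tsum_of_injective hΦ _)
        intro η
        simp only [Φ, wt, ew]
        rw [← ENNReal.ofReal_mul (Real.exp_pos _).le, ← Real.exp_add]
        apply ENNReal.ofReal_le_ofReal
        apply Real.exp_le_exp.mpr
        have := hf2 η
        nlinarith
    _ = (∑' c : CF, wt β c.1) * ∑' η : {η : Site → ℤ // (∀ x ∉ Λ, η x = 0) ∧ True}, ew p β η.1 := by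
        rw [ENNReal.tsum_prod', ← ENNReal.tsum_mul_right]
        apply tsum_congr
        intro c
        exact ENNReal.tsum_mul_left (a := wt β c.1)
          (f := fun η : {η : Site → ℤ // (∀ x ∉ Λ, η x = 0) ∧ True} => ew p β η.1)
    _ ≤ _ := by
        gcongr
        exact peierls_sum hβ

lemma WE_neg (p β : ℝ) (Λ : Finset Site) (A : (Site → ℤ) → Prop) :
    WE p β Λ A = WE p β Λ (fun η => A (-η)) := by
  unfold WE
  rw [← (Equiv.neg (Site → ℤ)).tsum_eq]
  apply tsum_congr
  intro η
  simp [ew, HH_neg]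

lemma center_half {p : ℝ} (hp : 1 ≤ p) {β : ℝ} (hβ : 10 ≤ β) {Λ : Finset Site} (hΛ : RowC Λ) :
    ENNReal.ofReal (1 / 2) * WE p β Λ (fun _ => True) ≤ WE p β Λ (fun η => η (0, 0) = 0) := by
  have h1 := peierls_pos hp hβ hΛ
  have h2 : WE p β Λ (fun η => η (0, 0) ≤ -1) = WE p β Λ (fun η => 1 ≤ η (0, 0)) := by
    rw [WE_neg]
    congr 1
    funext η
    simp
  have h3 : WE p β Λ (fun _ => True) ≤ WE p β Λ (fun η => η (0, 0) = 0) +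
      (WE p β Λ (fun η => 1 ≤ η (0, 0)) + WE p β Λ (fun η => η (0, 0) ≤ -1)) := by
    unfold WE
    rw [← ENNReal.tsum_add, ← ENNReal.tsum_add]
    apply ENNReal.tsum_le_tsum
    intro η
    by_cases hs : ∀ x ∉ Λ, η x = 0
    · rw [if_pos (⟨hs, trivial⟩ : (∀ x ∉ Λ, η x = 0) ∧ True)]
      rcases lt_trichotomy (η (0, 0)) 0 with h | h | h
      · have e1 : η (0, 0) ≤ -1 := by omega
        rw [if_pos (⟨hs, e1⟩ : (∀ x ∉ Λ, η x = 0) ∧ η (0, 0) ≤ -1)]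
        exact le_add_left (le_add_left le_rfl)
      · rw [if_pos (⟨hs, h⟩ : (∀ x ∉ Λ, η x = 0) ∧ η (0, 0) = 0)]
        exact le_add_right le_rfl
      · have e1 : 1 ≤ η (0, 0) := by omega
        rw [if_pos (⟨hs, e1⟩ : (∀ x ∉ Λ, η x = 0) ∧ 1 ≤ η (0, 0))]
        exact le_add_left (le_add_right le_rfl)
    · rw [if_neg (fun h => hs h.1)]
      exact zero_le
  rw [h2] at h3
  have hT := WE_ne_top hp (by linarith : 0 < β) Λ (fun _ => True)
  have h0 := WE_ne_top hp (by linarith : 0 < β) Λ (fun η => η (0, 0) = 0)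
  have hP := WE_ne_top hp (by linarith : 0 < β) Λ (fun η => 1 ≤ η (0, 0))
  rw [← ENNReal.toReal_le_toReal (by finiteness) (by finiteness)] at h1 h3 ⊢
  rw [ENNReal.toReal_add h0 (by finiteness), ENNReal.toReal_add hP hP] at h3
  rw [ENNReal.toReal_mul, ENNReal.toReal_ofReal (by norm_num)] at h1 ⊢
  linarith

def BoxR (R : ℕ) : Finset Site := (Finset.Icc (-(2 * R : ℤ)) (2 * R)) ×ˢ (Finset.Icc (-(2 * R : ℤ)) (2 * R))

def Rng (N : ℕ) : Finset ℤ := Finset.Icc (-(N : ℤ)) N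

def ext0 {R N : ℕ} (b : ↥(BoxR R) → ↥(Rng N)) : Site → ℤ :=
  fun x => if hx : x ∈ BoxR R then (b ⟨x, hx⟩).1 else 0

def oval (o : Option CF) : Site → ℤ := o.elim 0 (fun f => f.1)

def owt (b : ℝ) (o : Option CF) : ℝ≥0∞ := o.elim 1 (fun f => wt b f.1)

lemma decomp {p : ℝ} (hp : 1 ≤ p) {β : ℝ} (hβ : 0 < β) {Λ : Finset Site} (hΛ : RowC Λ)
    (h R : ℕ) (c : ℝ)
    (hc : ∀ k : ℕ, k ≤ h → c ≤ β * (Estar p * ((h : ℝ) - k) ^ p + R / 2 * k))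
    (η : Site → ℤ) (hη : ∀ x ∉ Λ, η x = 0) (h0 : η (0, 0) = h) :
    ∃ (g : Fin h → Option CF) (b : ↥(BoxR R) → ↥(Rng (h * R))) (η' : Site → ℤ),
      (∀ x ∉ Λ, η' x = 0) ∧ η = η' + ext0 b + ∑ k, oval (g k) ∧
      ew p β η ≤ ENNReal.ofReal (Real.exp (-c)) * ((∏ k, owt (β / 2) (g k)) * ew p β η') := by
  have hp0 : 0 < p := by linarith
  obtain ⟨F, hF, hcp⟩ := levels h (off_fin hη) h0.ge
  have hsupp := compat_supp hF hcp hΛ hη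
  let K : Finset (Fin h) := Finset.univ.filter (fun k => R ≤ len (F k))
  have hKc : ∀ k ∈ Kᶜ, len (F k) < R := by
    intro k hk
    simpa [K] using hk
  let ψ : Site → ℤ := ∑ k ∈ Kᶜ, F k
  have hsmall : ∀ k ∈ Kᶜ, ∀ x, x ∉ BoxR R → F k x = 0 := by
    rintro k hk ⟨x, y⟩ hx
    by_contra hne
    apply hx
    have h1 := (hF k).box hne
    have h2 := hKc k hk
    simp only [BoxR, Finset.mem_product, Finset.mem_Icc]
    have h3 := abs_le.mp h1.1
    have h4 := abs_le.mp h1.2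
    omega
  have hval : ∀ k ∈ Kᶜ, ∀ x, |F k x| ≤ R := by
    rintro k hk ⟨x, y⟩
    have h1 := abs_le_HH hp (hF k).fin x y
    rw [(hF k).HH_eq hp0] at h1
    have h2 : (len (F k) : ℝ) ≤ R := by exact_mod_cast (hKc k hk).le
    exact_mod_cast h1.trans h2
  have hψval : ∀ x, ψ x ∈ Rng (h * R) := by
    intro x
    have h1 : |ψ x| ≤ h * R := by
      simp only [ψ, Finset.sum_apply]
      refine (Finset.abs_sum_le_sum_abs _ _).trans ?_
      refine (Finset.sum_le_sum (fun k hk => hval k hk x)).trans ?_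
      rw [Finset.sum_const, nsmul_eq_mul]
      gcongr
      have := Finset.card_le_univ (Kᶜ)
      simpa using this
    rw [Rng, Finset.mem_Icc]
    push_cast
    exact abs_le.mp h1
  let g : Fin h → Option CF := fun k => if R ≤ len (F k) then some ⟨F k, hF k⟩ else none
  let b : ↥(BoxR R) → ↥(Rng (h * R)) := fun x => ⟨ψ x.1, hψval x.1⟩
  have hb : ext0 b = ψ := by
    funext x
    simp only [ext0, b]
    split_ifs with hx
    · rfl
    · simp only [ψ, Finset.sum_apply]
      exact (Finset.sum_eq_zero (fun k hk => hsmall k hk x hx)).symm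
  have hg : ∑ k, oval (g k) = ∑ k ∈ K, F k := by
    rw [Finset.sum_filter]
    apply Finset.sum_congr rfl
    intro k _
    simp only [g]
    split_ifs <;> simp [oval]
  refine ⟨g, b, η - ∑ k, F k, ?_, ?_, ?_⟩
  · intro x hx
    simp only [Pi.sub_apply, hη x hx, Finset.sum_apply]
    rw [Finset.sum_eq_zero (fun k _ => hsupp k x hx), sub_zero]
  · rw [hb, hg, ← Finset.sum_add_sum_compl K F]
    simp only [ψ]
    abel
  · have hprod : ∏ k, owt (β / 2) (g k) =
        ENNReal.ofReal (Real.exp (-(β / 2) * ∑ k ∈ K, (len (F k) : ℝ))) := by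
      rw [Finset.mul_sum, Finset.sum_filter, Real.exp_sum,
        ENNReal.ofReal_prod_of_nonneg (fun _ _ => (Real.exp_pos _).le)]
      apply Finset.prod_congr rfl
      intro k _
      simp only [g]
      split_ifs <;> simp [owt, wt]
    rw [hprod, ew, ew, ← ENNReal.ofReal_mul (Real.exp_pos _).le,
      ← ENNReal.ofReal_mul (Real.exp_pos _).le, ← Real.exp_add, ← Real.exp_add]
    apply ENNReal.ofReal_le_ofReal
    apply Real.exp_le_exp.mpr
    have e1 := energy_split hp (off_fin hη) (fun k => (hF k).fin) hcp K
    have hKh : K.card ≤ h := by simpa using Finset.card_le_univ K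
    have e2 : ∑ k ∈ K, HH p (F k) = ∑ k ∈ K, (len (F k) : ℝ) :=
      Finset.sum_congr rfl (fun k _ => (hF k).HH_eq hp0)
    have e3 : (K.card : ℝ) * R ≤ ∑ k ∈ K, (len (F k) : ℝ) := by
      rw [← nsmul_eq_mul]
      apply Finset.card_nsmul_le_sum
      intro k hk
      have : R ≤ len (F k) := by simpa [K] using hk
      exact_mod_cast this
    have e4 : Estar p * ((h : ℝ) - K.card) ^ p ≤ HH p (∑ k ∈ Kᶜ, F k) := by
      apply HH_ge hp0 (supp_sum_finite _ _ (fun k _ => (hF k).fin))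
      · have : (K.card : ℝ) ≤ h := by exact_mod_cast hKh
        linarith
      · have : ((Kᶜ).card : ℤ) * 1 ≤ (∑ k ∈ Kᶜ, F k) (0, 0) := by
          rw [Finset.sum_apply, ← nsmul_eq_mul]
          apply Finset.card_nsmul_le_sum
          intro k hk
          exact (hF k).pos
        have h5 : ((Kᶜ).card : ℤ) = h - K.card := by
          rw [Finset.card_compl, Fintype.card_fin]; omega
        rw [h5, mul_one] at this
        exact_mod_cast this
    have e5 := hc K.card hKh
    rw [e2] at e1
    have e6 : β * (HH p (η - ∑ k, F k) + HH p (∑ k ∈ Kᶜ, F k) + ∑ k ∈ K, (len (F k) : ℝ)) ≤ β * HH p η :=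
      mul_le_mul_of_nonneg_left e1 hβ.le
    have e7 : β * (Estar p * ((h : ℝ) - K.card) ^ p + R / 2 * K.card) ≤
       β * (HH p (∑ k ∈ Kᶜ, F k) + (1 / 2) * ∑ k ∈ K, (len (F k) : ℝ)) := by
      apply mul_le_mul_of_nonneg_left _ hβ.le
      linarith
    have e8 := e5.trans e7
    linarith

lemma upper {p : ℝ} (hp : 1 ≤ p) {β : ℝ} (hβ : 20 ≤ β) {Λ : Finset Site} (hΛ : RowC Λ)
    (h R : ℕ) (c : ℝ)
    (hc : ∀ k : ℕ, k ≤ h → c ≤ β * (Estar p * ((h : ℝ) - k) ^ p + R / 2 * k)) :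
    WE p β Λ (fun η => η (0, 0) = (h : ℤ)) ≤ ENNReal.ofReal (Real.exp (-c)) *
      (ENNReal.ofReal (5 / 4) ^ h * (((2 * (h * R) + 1) ^ ((4 * R + 1) ^ 2) : ℕ) *
        WE p β Λ (fun _ => True))) := by
  have hβ0 : 0 < β := by linarith
  have hd : ∀ η : {η : Site → ℤ // (∀ x ∉ Λ, η x = 0) ∧ η (0, 0) = (h : ℤ)},
      ∃ t : (Fin h → Option CF) × (↥(BoxR R) → ↥(Rng (h * R))) × {η : Site → ℤ // (∀ x ∉ Λ, η x = 0) ∧ True},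
        η.1 = t.2.2.1 + ext0 t.2.1 + ∑ k, oval (t.1 k) ∧
        ew p β η.1 ≤ ENNReal.ofReal (Real.exp (-c)) * ((∏ k, owt (β / 2) (t.1 k)) * ew p β t.2.2.1) := by
    intro η
    obtain ⟨g, b, η', h1, h2, h3⟩ := decomp hp hβ0 hΛ h R c hc η.1 η.2.1 η.2.2
    exact ⟨(g, b, ⟨η', h1, trivial⟩), h2, h3⟩
  choose Φ hΦ1 hΦ2 using hd
  have hinj : Function.Injective Φ := by
    intro η ξ he
    apply Subtype.ext
    rw [hΦ1 η, hΦ1 ξ, he]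
  rw [WE_sub p β Λ (fun _ => True), WE_sub]
  refine (ENNReal.tsum_le_tsum hΦ2).trans ?_
  refine (ENNReal.tsum_comp_le_tsum_of_injective hinj (fun t => ENNReal.ofReal (Real.exp (-c)) * ((∏ k, owt (β / 2) (t.1 k)) * ew p β t.2.2.1))).trans ?_
  rw [ENNReal.tsum_mul_left]
  gcongr
  rw [ENNReal.tsum_prod']
  have e1 : ∀ g : Fin h → Option CF, (∑' t : (↥(BoxR R) → ↥(Rng (h * R))) × {η : Site → ℤ // (∀ x ∉ Λ, η x = 0) ∧ True},
      (∏ k, owt (β / 2) (g k)) * ew p β t.2.1) = (∏ k, owt (β / 2) (g k)) *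
        (((2 * (h * R) + 1) ^ ((4 * R + 1) ^ 2) : ℕ) *
        ∑' η : {η : Site → ℤ // (∀ x ∉ Λ, η x = 0) ∧ True}, ew p β η.1) := by
    intro g
    rw [ENNReal.tsum_mul_left]
    congr 1
    rw [ENNReal.tsum_prod', tsum_fintype]
    dsimp only
    rw [Finset.sum_const, nsmul_eq_mul, Finset.card_univ]
    congr 2
    rw [Fintype.card_fun, Fintype.card_coe, Fintype.card_coe]
    have a1 : (Rng (h * R)).card = 2 * (h * R) + 1 := by
      rw [Rng, Int.card_Icc]; omega
    have a2 : (BoxR R).card = (4 * R + 1) ^ 2 := by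
      rw [BoxR, Finset.card_product, Int.card_Icc, sq]
      congr 1 <;> omega
    rw [a1, a2]
  refine (le_of_eq (tsum_congr e1)).trans ?_
  rw [ENNReal.tsum_mul_right]
  gcongr
  rw [tsum_pi_fin (owt (β / 2))]
  gcongr
  rw [tsum_opt]
  simp only [owt, Option.elim]
  refine (add_le_add_right (peierls_sum (by linarith)) 1).trans ?_
  rw [← ENNReal.ofReal_one, ← ENNReal.ofReal_add (by norm_num) (by norm_num)]
  apply ENNReal.ofReal_le_ofReal
  norm_num

lemma clarkson {p : ℝ} (hp1 : 1 ≤ p) (hp2 : p ≤ 2) (a b : ℝ) :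
    |a + b| ^ p + |a - b| ^ p ≤ 2 * |a| ^ p + 2 * |b| ^ p := by
  have hq0 : 0 ≤ p / 2 := by linarith
  have hq1 : p / 2 ≤ 1 := by linarith
  have key : ∀ x : ℝ, |x| ^ p = (x ^ 2) ^ (p / 2) := by
    intro x
    rw [← sq_abs, ← Real.rpow_natCast, ← Real.rpow_mul (abs_nonneg x)]
    congr 1
    push_cast; ring
  have hcc := Real.concaveOn_rpow hq0 hq1
  have h1 := hcc.2 (Set.mem_Ici.mpr (sq_nonneg (a + b))) (Set.mem_Ici.mpr (sq_nonneg (a - b)))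
    (by norm_num : (0 : ℝ) ≤ 1 / 2) (by norm_num : (0 : ℝ) ≤ 1 / 2) (by norm_num)
  simp only [smul_eq_mul] at h1
  have h2 : 1 / 2 * (a + b) ^ 2 + 1 / 2 * (a - b) ^ 2 = a ^ 2 + b ^ 2 := by ring
  rw [h2] at h1
  have h3 := Real.rpow_add_le_add_rpow (sq_nonneg a) (sq_nonneg b) hq0 hq1
  rw [key, key, key, key]
  linarith

lemma supp_add {f g : Site → ℤ} (hf : (Function.support f).Finite) (hg : (Function.support g).Finite) :
    (Function.support (f + g)).Finite :=
  (hf.union hg).subset (Function.support_add f g)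

lemma supp_neg {f : Site → ℤ} (hf : (Function.support f).Finite) :
    (Function.support (-f)).Finite := by
  rw [Function.support_neg]; exact hf

lemma HH_clarkson {p : ℝ} (hp1 : 1 ≤ p) (hp2 : p ≤ 2) {η ψ : Site → ℤ}
    (hη : (Function.support η).Finite) (hψ : (Function.support ψ).Finite) :
    HH p (η + ψ) + HH p (-η + ψ) ≤ 2 * HH p η + 2 * HH p ψ := by
  have hp0 : 0 < p := by linarith
  have s1 := HH_summable hp0 (supp_add hη hψ)
  have s2 := HH_summable hp0 (supp_add (supp_neg hη) hψ)
  have s3 := HH_summable hp0 hη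
  have s4 := HH_summable hp0 hψ
  unfold HH
  rw [← s1.tsum_add s2, ← tsum_mul_left, ← tsum_mul_left,
    ← (s3.mul_left 2).tsum_add (s4.mul_left 2)]
  refine (s1.add s2).tsum_le_tsum ?_ ((s3.mul_left 2).add (s4.mul_left 2))
  intro e
  have := clarkson hp1 hp2 ((dd η e : ℤ) : ℝ) ((dd ψ e : ℤ) : ℝ)
  rw [dd_add, dd_add, dd_neg]
  push_cast
  have e1 : -((dd η e : ℤ) : ℝ) + ((dd ψ e : ℤ) : ℝ) = -(((dd η e : ℤ) : ℝ) - ((dd ψ e : ℤ) : ℝ)) := by ring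
  rw [e1, abs_neg]
  exact this

lemma lower {p : ℝ} (hp1 : 1 ≤ p) (hp2 : p ≤ 2) {β : ℝ} (hβ : 0 < β) {Λ : Finset Site}
    (h : ℤ) (ψ : Site → ℤ) (hψ : ∀ x ∉ Λ, ψ x = 0) (h0 : ψ (0, 0) = h) :
    ENNReal.ofReal (Real.exp (-β * HH p ψ)) * WE p β Λ (fun η => η (0, 0) = 0) ≤
      WE p β Λ (fun η => η (0, 0) = h) := by
  have e1 : WE p β Λ (fun η => η (0, 0) = h) =
      ∑' η : Site → ℤ, if (∀ x ∉ Λ, η x = 0) ∧ η (0, 0) = 0 then ew p β (η + ψ) else 0 := by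
    unfold WE
    rw [← (Equiv.addRight ψ).tsum_eq]
    apply tsum_congr
    intro η
    have hiff : ((∀ x ∉ Λ, (η + ψ) x = 0) ∧ (η + ψ) (0, 0) = h) ↔
        ((∀ x ∉ Λ, η x = 0) ∧ η (0, 0) = 0) := by
      apply and_congr
      · apply forall₂_congr
        intro x hx
        simp [hψ x hx]
      · simp [h0]
    by_cases hs : (∀ x ∉ Λ, η x = 0) ∧ η (0, 0) = 0
    · exact (if_pos (hiff.mpr hs)).trans (if_pos hs).symm
    · exact (if_neg (fun h' => hs (hiff.mp h'))).trans (if_neg hs).symm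
  have e2 : WE p β Λ (fun η => η (0, 0) = h) =
      ∑' η : Site → ℤ, if (∀ x ∉ Λ, η x = 0) ∧ η (0, 0) = 0 then ew p β (-η + ψ) else 0 := by
    rw [e1, ← (Equiv.neg (Site → ℤ)).tsum_eq]
    apply tsum_congr
    intro η
    simp
  have e3 : 2 * (ENNReal.ofReal (Real.exp (-β * HH p ψ)) * WE p β Λ (fun η => η (0, 0) = 0)) ≤
      2 * WE p β Λ (fun η => η (0, 0) = h) := by
    rw [two_mul (WE p β Λ (fun η => η (0, 0) = h))]
    nth_rewrite 1 [e1]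
    rw [e2, ← ENNReal.tsum_add]
    unfold WE
    rw [← ENNReal.tsum_mul_left, ← ENNReal.tsum_mul_left]
    apply ENNReal.tsum_le_tsum
    intro η
    by_cases hs : (∀ x ∉ Λ, η x = 0) ∧ η (0, 0) = 0
    · rw [if_pos hs, if_pos hs, if_pos hs]
      simp only [ew]
      have h2 : (2 : ℝ≥0∞) = ENNReal.ofReal 2 := by simp
      rw [h2, ← ENNReal.ofReal_mul (Real.exp_pos _).le, ← ENNReal.ofReal_mul (by norm_num),
        ← ENNReal.ofReal_add (Real.exp_pos _).le (Real.exp_pos _).le]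
      apply ENNReal.ofReal_le_ofReal
      have hc := HH_clarkson hp1 hp2 (off_fin hs.1) (off_fin hψ)
      set u := -β * HH p (η + ψ) with hu
      set v := -β * HH p (-η + ψ) with hv
      have h3 : -β * HH p ψ + -β * HH p η ≤ u / 2 + v / 2 := by
        rw [hu, hv]; nlinarith
      rw [← Real.exp_add]
      have h4 := Real.exp_le_exp.mpr h3
      rw [Real.exp_add (u / 2)] at h4
      have h5 : Real.exp u = Real.exp (u / 2) ^ 2 := by rw [← Real.exp_nat_mul]; congr 1; push_cast; ring
      have h6 : Real.exp v = Real.exp (v / 2) ^ 2 := by rw [← Real.exp_nat_mul]; congr 1; push_cast; ring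
      rw [h5, h6]
      nlinarith [sq_nonneg (Real.exp (u / 2) - Real.exp (v / 2))]
    · rw [if_neg hs, if_neg hs, if_neg hs]; simp
  rwa [ENNReal.mul_le_mul_iff_right (by norm_num) (by norm_num)] at e3

lemma floor_energy {p : ℝ} (hp : 1 < p) {ε : ℝ} (hε : 0 < ε) :
    ∃ (S : Finset Site) (h₀ : ℕ), ∀ h : ℕ, h₀ ≤ h → ∃ ψ : Site → ℤ, ψ (0, 0) = h ∧
      (∀ x ∉ S, ψ x = 0) ∧ HH p ψ ≤ (Estar p + ε) * (h : ℝ) ^ p := by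
  have hp0 : 0 < p := by linarith
  have hne : {E | ∃ φ : Site → ℝ, (Function.support φ).Finite ∧ φ (0, 0) = 1 ∧ E = pDir p φ}.Nonempty := by
    refine ⟨_, fun x => if x = (0, 0) then 1 else 0, ?_, by simp, rfl⟩
    refine (Set.finite_singleton ((0, 0) : Site)).subset ?_
    intro x hx
    by_contra h'
    apply hx
    exact if_neg h'
  obtain ⟨_, ⟨φ, hφ, hφ0, rfl⟩, hlt⟩ := exists_lt_of_csInf_lt hne (show Estar p < Estar p + ε by linarith)
  have hD := dd_finite hφ
  have hsum : pDir p φ = ∑ e ∈ hD.toFinset, |dd φ e| ^ p := by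
    rw [pDir_eq hp0 hφ]
    apply tsum_eq_sum
    intro e he
    have : dd φ e = 0 := by simpa using he
    rw [this, rp0 hp0]
  have htend : Tendsto (fun h : ℕ => ∑ e ∈ hD.toFinset, (|dd φ e| + 1 / (h : ℝ)) ^ p) atTop
      (𝓝 (∑ e ∈ hD.toFinset, (|dd φ e| + 0) ^ p)) := by
    apply tendsto_finsetSum
    intro e _
    exact (tendsto_const_nhds.add tendsto_one_div_atTop_nhds_zero_nat).rpow_const (Or.inr hp0.le)
  simp only [add_zero] at htend
  rw [← hsum] at htend
  obtain ⟨h₀, hh⟩ := eventually_atTop.mp ((htend.eventually (gt_mem_nhds hlt)).and (eventually_ge_atTop 1))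
  refine ⟨hφ.toFinset, h₀, fun h hh0 => ⟨fun x => ⌊(h : ℝ) * φ x⌋, ?_, ?_, ?_⟩⟩
  · simp [hφ0]
  · intro x hx
    have : φ x = 0 := by simpa using hx
    simp [this]
  · obtain ⟨h1, h2⟩ := hh h hh0
    have hpos : (0 : ℝ) < h := by exact_mod_cast h2
    have e1 : HH p (fun x => ⌊(h : ℝ) * φ x⌋) =
        ∑ e ∈ hD.toFinset, |((dd (fun x => ⌊(h : ℝ) * φ x⌋) e : ℤ) : ℝ)| ^ p := by
      apply tsum_eq_sum
      intro e he
      have : dd φ e = 0 := by simpa using he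
      have h3 : φ (tgt e) = φ e.1 := by simpa [dd, sub_eq_zero] using this
      have h4 : dd (fun x => ⌊(h : ℝ) * φ x⌋) e = 0 := by simp [dd, h3]
      rw [h4, Int.cast_zero, rp0 hp0]
    rw [e1]
    calc ∑ e ∈ hD.toFinset, |((dd (fun x => ⌊(h : ℝ) * φ x⌋) e : ℤ) : ℝ)| ^ p
        ≤ ∑ e ∈ hD.toFinset, (|dd φ e| + 1 / (h : ℝ)) ^ p * (h : ℝ) ^ p := by
          apply Finset.sum_le_sum
          intro e _
          rw [← Real.mul_rpow (by positivity) hpos.le]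
          apply Real.rpow_le_rpow (abs_nonneg _) _ hp0.le
          have h3 : (|dd φ e| + 1 / (h : ℝ)) * h = |(h : ℝ) * φ (tgt e) - h * φ e.1| + 1 := by
            rw [← mul_sub, abs_mul, abs_of_pos hpos, dd]; field_simp
          rw [h3]
          simp only [dd]
          push_cast
          have a1 := Int.floor_le ((h : ℝ) * φ (tgt e))
          have a2 := Int.lt_floor_add_one ((h : ℝ) * φ (tgt e))
          have b1 := Int.floor_le ((h : ℝ) * φ e.1)
          have b2 := Int.lt_floor_add_one ((h : ℝ) * φ e.1)
          have c1 := le_abs_self ((h : ℝ) * φ (tgt e) - h * φ e.1)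
          have c2 := neg_abs_le ((h : ℝ) * φ (tgt e) - h * φ e.1)
          rw [abs_le]
          constructor <;> linarith
      _ = (∑ e ∈ hD.toFinset, (|dd φ e| + 1 / (h : ℝ)) ^ p) * (h : ℝ) ^ p := by
          rw [Finset.sum_mul]
      _ ≤ _ := by
          gcongr

lemma rpow_large {s : ℝ} (hs : 0 < s) (C : ℝ) : ∀ᶠ h : ℕ in atTop, C ≤ (h : ℝ) ^ s :=
  ((tendsto_rpow_atTop hs).comp tendsto_natCast_atTop_atTop).eventually_ge_atTop C

lemma upper_asym {p : ℝ} (hp1 : 1 < p) (hp2 : p < 2) {β : ℝ} (hβ : 0 < β) {E : ℝ} (hE : 0 ≤ E)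
    {ε : ℝ} (hε : 0 < ε) :
    ∃ h₀ : ℕ, ∀ h : ℕ, h₀ ≤ h → ∃ (R : ℕ) (c : ℝ),
      (∀ k : ℕ, k ≤ h → c ≤ β * (E * ((h : ℝ) - k) ^ p + R / 2 * k)) ∧
      Real.exp (-c) * ((5 / 4) ^ h * (((2 * (h * R) + 1) ^ ((4 * R + 1) ^ 2) : ℕ) : ℝ)) ≤
        Real.exp (-β * (E - ε) * (h : ℝ) ^ p) := by
  have hp0 : 0 < p := by linarith
  obtain ⟨δ, hδ0, hδ1, hδ⟩ : ∃ δ : ℝ, 0 < δ ∧ δ < 1 ∧ E - ε / 2 < E * (1 - δ) ^ p := by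
    have ht : Tendsto (fun δ : ℝ => E * (1 - δ) ^ p) (𝓝 0) (𝓝 (E * (1 - 0) ^ p)) := by
      apply Tendsto.const_mul
      exact (tendsto_const_nhds.sub tendsto_id).rpow_const (Or.inr hp0.le)
    rw [sub_zero, Real.one_rpow, mul_one] at ht
    have h1 := (ht.eventually (lt_mem_nhds (show E - ε / 2 < E by linarith))).and
      (gt_mem_nhds (show (0 : ℝ) < 1 by norm_num))
    have h2 : ∀ᶠ δ : ℝ in 𝓝[>] 0, 0 < δ ∧ δ < 1 ∧ E - ε / 2 < E * (1 - δ) ^ p := by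
      filter_upwards [h1.filter_mono nhdsWithin_le_nhds, self_mem_nhdsWithin] with δ a b
      exact ⟨b, a.2, a.1⟩
    exact h2.exists
  set α : ℝ := 3 * p / 4 - 1 / 2 with hα
  have hα0 : 0 < α := by linarith
  have hα1 : α ≤ 1 := by linarith
  set s : ℝ := (p - 2 * α) / 4 with hs
  have hs0 : 0 < s := by linarith
  have ev := ((rpow_large (show 0 < 1 + α - p by linarith) (E * 2 / δ)).and
    (rpow_large (show 0 < p - 1 by linarith) (4 / (β * ε)))).and
    ((rpow_large (show 0 < 2 * s by linarith) (81 * (5 ^ s / s) * 4 / (β * ε))).and (eventually_ge_atTop 1))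
  obtain ⟨h₀, hh⟩ := eventually_atTop.mp ev
  refine ⟨h₀, fun h hle => ?_⟩
  obtain ⟨⟨v1, v2⟩, v3, v4⟩ := hh h hle
  set x : ℝ := (h : ℝ) with hx
  have hx1 : 1 ≤ x := by rw [hx]; exact_mod_cast v4
  have hx0 : 0 < x := by linarith
  have hxα : 1 ≤ x ^ α := Real.one_le_rpow hx1 hα0.le
  have hxα1 : x ^ α ≤ x := by
    calc x ^ α ≤ x ^ (1 : ℝ) := Real.rpow_le_rpow_of_exponent_le hx1 hα1
      _ = x := Real.rpow_one x
  have hR1 : x ^ α ≤ (⌈x ^ α⌉₊ : ℝ) := Nat.le_ceil _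
  have hR2 : (⌈x ^ α⌉₊ : ℝ) ≤ 2 * x ^ α := by
    have := Nat.ceil_lt_add_one (show 0 ≤ x ^ α by linarith)
    linarith
  set R : ℕ := ⌈x ^ α⌉₊ with hRdef
  have hxp : 0 < x ^ p := Real.rpow_pos_of_pos hx0 p
  refine ⟨R, β * (E * (1 - δ) ^ p * x ^ p), ?_, ?_⟩
  · intro k hk
    have hkx : (k : ℝ) ≤ x := by rw [hx]; exact_mod_cast hk
    have hk0 : (0 : ℝ) ≤ k := Nat.cast_nonneg k
    apply mul_le_mul_of_nonneg_left _ hβ.le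
    by_cases hkd : (k : ℝ) ≤ δ * x
    · have h1 : (1 - δ) ^ p * x ^ p ≤ (x - k) ^ p := by
        rw [← Real.mul_rpow (by linarith) hx0.le]
        apply Real.rpow_le_rpow _ _ hp0.le
        · exact mul_nonneg (by linarith) hx0.le
        · linarith
      have h2 : 0 ≤ (R : ℝ) / 2 * k := by positivity
      have h3 := mul_le_mul_of_nonneg_left h1 hE
      linarith
    · push Not at hkd
      have h1 : 0 ≤ E * (x - k) ^ p := mul_nonneg hE (Real.rpow_nonneg (by linarith) _)
      have h2 : (1 - δ) ^ p ≤ 1 := Real.rpow_le_one (by linarith) (by linarith) hp0.le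
      have h3 : E * (1 - δ) ^ p * x ^ p ≤ E * x ^ p := by
        apply mul_le_mul_of_nonneg_right _ hxp.le
        exact mul_le_of_le_one_right hE h2
      have h4 : E ≤ δ / 2 * x ^ (1 + α - p) := by
        rw [div_le_iff₀ hδ0] at v1
        linarith
      have h5 : E * x ^ p ≤ δ / 2 * (x ^ α * x) := by
        have : x ^ (1 + α - p) * x ^ p = x ^ α * x := by
          rw [← Real.rpow_add hx0]
          nth_rewrite 3 [← Real.rpow_one x]
          rw [← Real.rpow_add hx0]
          congr 1; ring
        calc E * x ^ p ≤ δ / 2 * x ^ (1 + α - p) * x ^ p := by gcongr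
          _ = _ := by rw [mul_assoc, this]
      have h6 : x ^ α * (δ * x) ≤ R * k := by
        apply mul_le_mul hR1 hkd.le (by positivity) (by positivity)
      linarith
  · have hN : (0 : ℝ) < 2 * (x * R) + 1 := by positivity
    have e1 : (((2 * (h * R) + 1) ^ ((4 * R + 1) ^ 2) : ℕ) : ℝ) =
        Real.exp (((4 * R + 1) ^ 2 : ℝ) * Real.log (2 * (x * R) + 1)) := by
      have := Real.exp_nat_mul (Real.log (2 * (x * R) + 1)) ((4 * R + 1) ^ 2)
      rw [Real.exp_log hN] at this
      push_cast at this ⊢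
      rw [this]
    have e2 : ((5 : ℝ) / 4) ^ h ≤ Real.exp x := by
      have : (5 : ℝ) / 4 ≤ Real.exp 1 := by
        have := Real.add_one_le_exp (1 : ℝ); linarith
      calc ((5 : ℝ) / 4) ^ h ≤ Real.exp 1 ^ h := by gcongr
        _ = Real.exp x := by rw [← Real.exp_nat_mul, mul_one]
    rw [e1]
    calc Real.exp (-(β * (E * (1 - δ) ^ p * x ^ p))) * ((5 / 4) ^ h * Real.exp (((4 * R + 1) ^ 2 : ℝ) * Real.log (2 * (x * R) + 1)))
        ≤ Real.exp (-(β * (E * (1 - δ) ^ p * x ^ p))) * (Real.exp x * Real.exp (((4 * R + 1) ^ 2 : ℝ) * Real.log (2 * (x * R) + 1))) := by gcongr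
      _ = Real.exp (-(β * (E * (1 - δ) ^ p * x ^ p)) + (x + ((4 * R + 1) ^ 2 : ℝ) * Real.log (2 * (x * R) + 1))) := by
          rw [Real.exp_add, Real.exp_add]
      _ ≤ _ := by
        apply Real.exp_le_exp.mpr
        have hbe : 0 < β * ε := mul_pos hβ hε
        have f1 : x ≤ β * ε / 4 * x ^ p := by
          rw [div_le_iff₀ hbe] at v2
          have : x ^ (p - 1) * x = x ^ p := by
            nth_rewrite 2 [← Real.rpow_one x]
            rw [← Real.rpow_add hx0]
            congr 1; ring
          rw [← this]
          nlinarith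
        have f2 : Real.log (2 * (x * R) + 1) ≤ 5 ^ s / s * x ^ (2 * s) := by
          have g1 : 2 * (x * R) + 1 ≤ 5 * x ^ 2 := by nlinarith
          calc Real.log (2 * (x * R) + 1) ≤ Real.log (5 * x ^ 2) := Real.log_le_log hN g1
            _ ≤ (5 * x ^ 2) ^ s / s := Real.log_le_rpow_div (by positivity) hs0
            _ = 5 ^ s / s * x ^ (2 * s) := by
              rw [Real.mul_rpow (by norm_num) (by positivity), ← Real.rpow_natCast x 2,
                ← Real.rpow_mul hx0.le]
              push_cast; ring
        have f3 : ((4 * R + 1) ^ 2 : ℝ) ≤ 81 * x ^ (2 * α) := by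
          have : x ^ (2 * α) = (x ^ α) ^ 2 := by
            rw [← Real.rpow_natCast (x ^ α) 2, ← Real.rpow_mul hx0.le]; congr 1; push_cast; ring
          rw [this]
          have g2 : (4 * R + 1 : ℝ) ≤ 9 * x ^ α := by linarith
          calc ((4 * R + 1) ^ 2 : ℝ) ≤ (9 * x ^ α) ^ 2 := by gcongr
            _ = _ := by ring
        have f4 : ((4 * R + 1) ^ 2 : ℝ) * Real.log (2 * (x * R) + 1) ≤ β * ε / 4 * x ^ p := by
          have g0 : 0 ≤ Real.log (2 * (x * R) + 1) := Real.log_nonneg (by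
            have : 0 ≤ x * R := by positivity
            linarith)
          have g3 : 81 * (5 ^ s / s) ≤ β * ε / 4 * x ^ (2 * s) := by
            rw [div_le_iff₀ hbe] at v3
            linarith
          have g4 : x ^ (2 * α) * x ^ (2 * s) * x ^ (2 * s) = x ^ p := by
            rw [← Real.rpow_add hx0, ← Real.rpow_add hx0]
            congr 1
            rw [hs]; ring
          calc ((4 * R + 1) ^ 2 : ℝ) * Real.log (2 * (x * R) + 1)
              ≤ (81 * x ^ (2 * α)) * (5 ^ s / s * x ^ (2 * s)) := by
                apply mul_le_mul f3 f2 g0 (by positivity)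
            _ = (81 * (5 ^ s / s)) * (x ^ (2 * α) * x ^ (2 * s)) := by ring
            _ ≤ (β * ε / 4 * x ^ (2 * s)) * (x ^ (2 * α) * x ^ (2 * s)) := by
                gcongr
            _ = β * ε / 4 * (x ^ (2 * α) * x ^ (2 * s) * x ^ (2 * s)) := by ring
            _ = _ := by rw [g4]
        have f5 : β * ((E - ε / 2) * x ^ p) ≤ β * (E * (1 - δ) ^ p * x ^ p) := by
          gcongr
        linarith

lemma ball_contains (S : Finset Site) : ∃ L₀ : ℕ, ∀ L : ℕ, L₀ ≤ L → S ⊆ ball L := by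
  refine ⟨2 * S.sup (fun x => max x.1.natAbs x.2.natAbs), fun L hL x hx => ?_⟩
  have h1 := Finset.le_sup (f := fun x : Site => max x.1.natAbs x.2.natAbs) hx
  have h2 : 2 * x.1.natAbs ≤ L := by omega
  have h3 : 2 * x.2.natAbs ≤ L := by omega
  simp only [ball, Finset.mem_filter, Finset.mem_product, Finset.mem_Icc, Int.ceil_natCast]
  refine ⟨by omega, ?_⟩
  have a1 : |(2 * x.1 : ℤ)| ≤ |(L : ℤ)| := by rw [abs_le, abs_of_nonneg (by omega)]; omega
  have a2 : |(2 * x.2 : ℤ)| ≤ |(L : ℤ)| := by rw [abs_le, abs_of_nonneg (by omega)]; omega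
  have b1 := sq_le_sq.mpr a1
  have b2 := sq_le_sq.mpr a2
  have : x.1 ^ 2 + x.2 ^ 2 ≤ (L : ℤ) ^ 2 := by nlinarith [sq_nonneg (L : ℤ)]
  exact_mod_cast this

theorem main_aux (p : ℝ) (hp1 : 1 < p) (hp2 : p < 2) :
    ∃ β₀ > (0 : ℝ), ∀ β ≥ β₀, ∀ ε > (0 : ℝ), ∃ h₀ : ℕ, ∀ h : ℕ, h₀ ≤ h →
      ∃ L₀ : ℕ, ∀ L : ℕ, L₀ ≤ L →
        Real.exp (-β * (Estar p + ε) * (h : ℝ) ^ p) ≤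
            pProb p β (ball L) (fun η => η (0, 0) = (h : ℤ)) ∧
          pProb p β (ball L) (fun η => η (0, 0) = (h : ℤ)) ≤
            Real.exp (-β * (Estar p - ε) * (h : ℝ) ^ p) := by
  refine ⟨20, by norm_num, fun β hβ ε hε => ?_⟩
  have hp0 : 0 < p := by linarith
  have hβ0 : 0 < β := by linarith
  obtain ⟨S, h1, hS⟩ := floor_energy hp1 (show 0 < ε / 2 by linarith)
  obtain ⟨h2, hU⟩ := upper_asym hp1 hp2 hβ0 (Estar_nonneg (p := p)) hε
  obtain ⟨h3, hl⟩ := eventually_atTop.mp (rpow_large hp0 (2 * Real.log 2 / (β * ε)))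
  obtain ⟨L₀, hL₀⟩ := ball_contains S
  refine ⟨max h1 (max h2 h3), fun h hh => ⟨L₀, fun L hL => ?_⟩⟩
  have hh1 : h1 ≤ h := by omega
  have hh2 : h2 ≤ h := by omega
  have hh3 : h3 ≤ h := by omega
  have hT := WE_ne_top hp1.le hβ0 (ball L) (fun _ => True)
  have hA := WE_ne_top hp1.le hβ0 (ball L) (fun η => η (0, 0) = (h : ℤ))
  have hpos : 0 < (WE p β (ball L) (fun _ => True)).toReal := ENNReal.toReal_pos (WE_pos _ _ _).ne' hT
  have hrow := ball_rowC (L : ℝ)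
  unfold pProb
  rw [pW_eq hp0, pW_eq hp0]
  constructor
  · obtain ⟨ψ, hψ0, hψS, hψE⟩ := hS h hh1
    have c1 := center_half hp1.le (by linarith : 10 ≤ β) hrow
    have c2 := lower hp1.le hp2.le hβ0 (Λ := ball L) h ψ (fun x hx => hψS x (fun h' => hx (hL₀ L hL h'))) hψ0
    have c3 := (mul_le_mul_right c1 (ENNReal.ofReal (Real.exp (-β * HH p ψ)))).trans c2
    have c4 := ENNReal.toReal_mono hA c3
    rw [ENNReal.toReal_mul, ENNReal.toReal_mul, ENNReal.toReal_ofReal (Real.exp_pos _).le,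
      ENNReal.toReal_ofReal (by norm_num)] at c4
    rw [le_div_iff₀ hpos]
    refine le_trans ?_ c4
    rw [← mul_assoc]
    apply mul_le_mul_of_nonneg_right _ hpos.le
    have d1 : Real.exp (-Real.log 2) = 1 / 2 := by
      rw [Real.exp_neg, Real.exp_log (by norm_num)]; norm_num
    rw [← d1, ← Real.exp_add]
    apply Real.exp_le_exp.mpr
    have d2 := hl h hh3
    rw [div_le_iff₀ (mul_pos hβ0 hε)] at d2
    have d3 := mul_le_mul_of_nonneg_left hψE hβ0.le
    linarith
  · obtain ⟨R, c, hc, hfin⟩ := hU h hh2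
    have c1 := upper hp1.le hβ hrow h R c hc
    have c2 := ENNReal.toReal_mono (by finiteness) c1
    rw [ENNReal.toReal_mul, ENNReal.toReal_mul, ENNReal.toReal_mul, ENNReal.toReal_pow,
      ENNReal.toReal_natCast, ENNReal.toReal_ofReal (Real.exp_pos _).le,
      ENNReal.toReal_ofReal (by norm_num)] at c2
    rw [div_le_iff₀ hpos]
    refine c2.trans ?_
    refine le_trans (le_of_eq ?_) (mul_le_mul_of_nonneg_right hfin hpos.le)
    ring
/-- **Lemma 4.2.** Single-site large deviation rate for the `p`-SOS model, `1 < p < 2`: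
`π^{(p)}(η_0 = h) = exp(−β(E*(p) ± ε) h^p)`. -/
theorem pSOS_large_deviation_rate (p : ℝ) (hp1 : 1 < p) (hp2 : p < 2) :
    ∃ β₀ > (0 : ℝ), ∀ β ≥ β₀, ∀ ε > (0 : ℝ), ∃ h₀ : ℕ, ∀ h : ℕ, h₀ ≤ h →
      ∃ L₀ : ℕ, ∀ L : ℕ, L₀ ≤ L →
        Real.exp (-β * (Estar p + ε) * (h : ℝ) ^ p) ≤
            pProb p β (ball L) (fun η => η (0, 0) = (h : ℤ)) ∧
          pProb p β (ball L) (fun η => η (0, 0) = (h : ℤ)) ≤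
            Real.exp (-β * (Estar p - ε) * (h : ℝ) ^ p) := by
  exact main_aux p hp1 hp2
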